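/- If x ∈ X, 0 < r < R < (1/8) diam X, and A ⊂ B(x,r), then there exists a set E ⊂ X such that χ_E is a solution of the K_{A,0}(B(x,R))-obstacle problem and P(E,X) ≤ cap₁(A, B(x,R)). -/

import Mathlib

open MeasureTheory Metric Filter Set
open scoped ENNReal NNReal Topology

noncomputable section

namespace MetricBV

variable {X : Type*} [MetricSpace X] [MeasurableSpace X]

/-- A rectifiable curve, encoded as a Lipschitz map on the interval `[0,1]`
(every rectifiable curve admits such a reparametrization). -/
structure Curve (X : Type*) [MetricSpace X] where
  toFun : ℝ → X
  lipschitz : ∃ K : ℝ≥0, LipschitzOnWith K toFun (Set.Icc 0 1)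

/-- The metric speed of a curve at a point. -/
def speed (γ : ℝ → X) (t : ℝ) : ℝ≥0∞ :=
  Filter.limsup (fun h : ℝ => ENNReal.ofReal (dist (γ (t + h)) (γ t) / |h|)) (𝓝[≠] (0 : ℝ))

/-- The curve integral `∫_γ g ds`. -/
def curveIntegral (g : X → ℝ≥0∞) (γ : Curve X) : ℝ≥0∞ :=
  ∫⁻ t in Set.Icc (0 : ℝ) 1, g (γ.toFun t) * speed γ.toFun t

/-- A curve lies in a set `Ω`. -/
def Curve.In (γ : Curve X) (Ω : Set X) : Prop :=
  ∀ t ∈ Set.Icc (0 : ℝ) 1, γ.toFun t ∈ Ω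

/-- The 1-modulus of a family of curves. -/
def Mod1 (μ : Measure X) (Γ : Set (Curve X)) : ℝ≥0∞ :=
  ⨅ (ρ : X → ℝ≥0∞) (_ : Measurable ρ) (_ : ∀ γ ∈ Γ, 1 ≤ curveIntegral ρ γ),
    ∫⁻ x, ρ x ∂μ

/-- `g` is an upper gradient of `u` in `Ω`: the upper gradient inequality holds
along every curve contained in `Ω`. -/
def IsUpperGradientOn (g : X → ℝ≥0∞) (u : X → ℝ) (Ω : Set X) : Prop :=
  ∀ γ : Curve X, γ.In Ω →
    ENNReal.ofReal |u (γ.toFun 1) - u (γ.toFun 0)| ≤ curveIntegral g γ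

/-- `g` is a 1-weak upper gradient of `u` in `Ω`: the upper gradient inequality holds
along every curve in `Ω` outside a family of zero 1-modulus. -/
def IsWeakUpperGradientOn (μ : Measure X) (g : X → ℝ≥0∞) (u : X → ℝ) (Ω : Set X) : Prop :=
  ∃ Γ : Set (Curve X), Mod1 μ Γ = 0 ∧
    ∀ γ : Curve X, γ ∉ Γ → γ.In Ω →
      ENNReal.ofReal |u (γ.toFun 1) - u (γ.toFun 0)| ≤ curveIntegral g γ

/-- Membership in the Newtonian space `N^{1,1}(X)`. -/
def MemN11 (μ : Measure X) (u : X → ℝ) : Prop :=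
  Integrable u μ ∧ ∃ g : X → ℝ≥0∞, Measurable g ∧
    IsWeakUpperGradientOn μ g u Set.univ ∧ ∫⁻ x, g x ∂μ < ⊤

/-- The 1-capacity `cap₁(A) = inf ‖u‖_{N^{1,1}(X)}` over `u ∈ N^{1,1}(X)` with `u ≥ 1` on `A`. -/
def cap1 (μ : Measure X) (A : Set X) : ℝ≥0∞ :=
  ⨅ (u : X → ℝ) (_ : MemN11 μ u) (_ : ∀ x ∈ A, 1 ≤ u x)
    (g : X → ℝ≥0∞) (_ : Measurable g) (_ : IsWeakUpperGradientOn μ g u Set.univ),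
    (∫⁻ x, ENNReal.ofReal |u x| ∂μ + ∫⁻ x, g x ∂μ)

/-- The variational 1-capacity `cap₁(A,Ω) = inf ∫ g_u dμ` over `u ∈ N^{1,1}(X)` with
`u ≥ 1` on `A` and `u = 0` on `X ∖ Ω`. -/
def vcap1 (μ : Measure X) (A Ω : Set X) : ℝ≥0∞ :=
  ⨅ (u : X → ℝ) (_ : MemN11 μ u) (_ : ∀ x ∈ A, 1 ≤ u x) (_ : ∀ x ∈ Ωᶜ, u x = 0)
    (g : X → ℝ≥0∞) (_ : Measurable g) (_ : IsWeakUpperGradientOn μ g u Set.univ),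
    ∫⁻ x, g x ∂μ

/-- Locally Lipschitz in `Ω`: Lipschitz on every compact subset of `Ω`. -/
def LocLipschitzOn (u : X → ℝ) (Ω : Set X) : Prop :=
  ∀ K : Set X, IsCompact K → K ⊆ Ω → ∃ L : ℝ≥0, LipschitzOnWith L u K

/-- Convergence `v i → u` in `L¹_loc(Ω)`. -/
def TendstoL1Loc (μ : Measure X) (v : ℕ → X → ℝ) (u : X → ℝ) (Ω : Set X) : Prop :=
  ∀ K : Set X, IsCompact K → K ⊆ Ω →
    Filter.Tendsto (fun i => ∫⁻ x in K, ENNReal.ofReal |v i x - u x| ∂μ)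
      Filter.atTop (𝓝 0)

/-- The total variation `‖Du‖(Ω)` of `u` in an open set `Ω`: the infimum of
`liminf ∫_Ω g_i dμ` over sequences of locally Lipschitz functions `v i → u` in `L¹_loc(Ω)`
with `g i` a 1-weak upper gradient of `v i` in `Ω`. -/
def tv (μ : Measure X) (u : X → ℝ) (Ω : Set X) : ℝ≥0∞ :=
  ⨅ (v : ℕ → X → ℝ) (_ : ∀ i, LocLipschitzOn (v i) Ω) (_ : TendstoL1Loc μ v u Ω)
    (g : ℕ → X → ℝ≥0∞) (_ : ∀ i, Measurable (g i))
    (_ : ∀ i, IsWeakUpperGradientOn μ (g i) (v i) Ω),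
    Filter.liminf (fun i => ∫⁻ x in Ω, g i x ∂μ) Filter.atTop

/-- The total variation `‖Du‖(A)` for an arbitrary set `A`. -/
def tvs (μ : Measure X) (u : X → ℝ) (A : Set X) : ℝ≥0∞ :=
  ⨅ (U : Set X) (_ : IsOpen U) (_ : A ⊆ U), tv μ u U

/-- The characteristic function of a set, as a real-valued function. -/
def chi (E : Set X) : X → ℝ := Set.indicator E fun _ => (1 : ℝ)

/-- The perimeter `P(E,Ω) = ‖Dχ_E‖(Ω)` of `E` in an open set `Ω`. -/
def perim (μ : Measure X) (E : Set X) (Ω : Set X) : ℝ≥0∞ := tv μ (chi E) Ω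

/-- `u ∈ BV(Ω)`: `u ∈ L¹(Ω)` and `‖Du‖(Ω) < ∞`. -/
def MemBV (μ : Measure X) (u : X → ℝ) (Ω : Set X) : Prop :=
  IntegrableOn u Ω μ ∧ tv μ u Ω < ⊤

/-- `u ∈ BV_loc(Ω)`. -/
def MemBVloc (μ : Measure X) (u : X → ℝ) (Ω : Set X) : Prop :=
  ∀ K : Set X, IsCompact K → K ⊆ Ω → ∃ U : Set X, IsOpen U ∧ K ⊆ U ∧ U ⊆ Ω ∧ MemBV μ u U

/-- `φ ∈ BV_c(Ω)`: a BV function with compact support in `Ω`. -/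
def MemBVc (μ : Measure X) (φ : X → ℝ) (Ω : Set X) : Prop :=
  MemBV μ φ Ω ∧ IsCompact (tsupport φ) ∧ tsupport φ ⊆ Ω

/-- `u` is a 1-minimizer (function of least gradient) in `Ω`. -/
def IsMinimizer (μ : Measure X) (u : X → ℝ) (Ω : Set X) : Prop :=
  MemBVloc μ u Ω ∧ ∀ φ : X → ℝ, MemBVc μ φ Ω →
    tvs μ u (tsupport φ) ≤ tvs μ (fun y => u y + φ y) (tsupport φ)

/-- `u` is a 1-superminimizer in `Ω`. -/
def IsSuperminimizer (μ : Measure X) (u : X → ℝ) (Ω : Set X) : Prop :=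
  MemBVloc μ u Ω ∧ ∀ φ : X → ℝ, MemBVc μ φ Ω → (∀ x, 0 ≤ φ x) →
    tvs μ u (tsupport φ) ≤ tvs μ (fun y => u y + φ y) (tsupport φ)

/-- `u` is a 1-subminimizer in `Ω`. -/
def IsSubminimizer (μ : Measure X) (u : X → ℝ) (Ω : Set X) : Prop :=
  MemBVloc μ u Ω ∧ ∀ φ : X → ℝ, MemBVc μ φ Ω → (∀ x, φ x ≤ 0) →
    tvs μ u (tsupport φ) ≤ tvs μ (fun y => u y + φ y) (tsupport φ)

/-- The lower approximate limit `u^∧(x)`, with values in `[-∞,∞]`. -/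
def lowerApprox (μ : Measure X) (u : X → ℝ) (x : X) : EReal :=
  sSup ((fun t : ℝ => (t : EReal)) '' {t : ℝ | Filter.Tendsto
    (fun r : ℝ => μ ({y | u y < t} ∩ Metric.ball x r) / μ (Metric.ball x r))
    (𝓝[>] (0 : ℝ)) (𝓝 0)})

/-- The upper approximate limit `u^∨(x)`, with values in `[-∞,∞]`. -/
def upperApprox (μ : Measure X) (u : X → ℝ) (x : X) : EReal :=
  sInf ((fun t : ℝ => (t : EReal)) '' {t : ℝ | Filter.Tendsto
    (fun r : ℝ => μ ({y | t < u y} ∩ Metric.ball x r) / μ (Metric.ball x r))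
    (𝓝[>] (0 : ℝ)) (𝓝 0)})

/-- The upper approximate limit of an extended-real-valued function. -/
def upperApproxE (μ : Measure X) (ψ : X → EReal) (x : X) : EReal :=
  sInf ((fun t : ℝ => (t : EReal)) '' {t : ℝ | Filter.Tendsto
    (fun r : ℝ => μ ({y | (t : EReal) < ψ y} ∩ Metric.ball x r) / μ (Metric.ball x r))
    (𝓝[>] (0 : ℝ)) (𝓝 0)})

/-- The measure-theoretic interior `I_E`. -/
def measInterior (μ : Measure X) (E : Set X) : Set X :=
  {x : X | Filter.Tendsto (fun r : ℝ => μ (Metric.ball x r \ E) / μ (Metric.ball x r))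
    (𝓝[>] (0 : ℝ)) (𝓝 0)}

/-- The measure-theoretic boundary `∂*E`. -/
def measBoundary (μ : Measure X) (E : Set X) : Set X :=
  {x : X | 0 < Filter.limsup (fun r : ℝ => μ (Metric.ball x r ∩ E) / μ (Metric.ball x r))
      (𝓝[>] (0 : ℝ)) ∧
    0 < Filter.limsup (fun r : ℝ => μ (Metric.ball x r \ E) / μ (Metric.ball x r))
      (𝓝[>] (0 : ℝ))}

/-- `A` is 1-thin at `x`. -/
def IsThinAt (μ : Measure X) (A : Set X) (x : X) : Prop :=
  Filter.Tendsto (fun r : ℝ =>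
      ENNReal.ofReal r * vcap1 μ (A ∩ Metric.ball x r) (Metric.ball x (2 * r))
        / μ (Metric.ball x r))
    (𝓝[>] (0 : ℝ)) (𝓝 0)

/-- `U` is 1-finely open. -/
def IsFinelyOpen (μ : Measure X) (U : Set X) : Prop :=
  ∀ x ∈ U, IsThinAt μ Uᶜ x

/-- The class `K_{ψ,f}(Ω)` of admissible functions for the obstacle problem. -/
def MemK (μ : Measure X) (ψ : X → EReal) (f : X → ℝ) (Ω : Set X) (u : X → ℝ) : Prop :=
  MemBVloc μ u Set.univ ∧ (∀ᵐ x ∂μ, x ∈ Ω → ψ x ≤ (u x : EReal)) ∧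
    (∀ᵐ x ∂μ, x ∉ Ω → u x = f x)

/-- `u` is a solution of the `K_{ψ,f}(Ω)`-obstacle problem. -/
def IsObstacleSolution (μ : Measure X) (ψ : X → EReal) (f : X → ℝ) (Ω : Set X)
    (u : X → ℝ) : Prop :=
  MemK μ ψ f Ω u ∧ ∀ v : X → ℝ, MemK μ ψ f Ω v → tv μ u Set.univ ≤ tv μ v Set.univ

/-- The standing assumptions: `(X,d,μ)` is a complete metric space with at least two points,
`μ` is a doubling measure with constant `Cd`, and `X` supports a `(1,1)`-Poincaré inequality
with constants `CP`, `lam`. -/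
structure MMS {X : Type*} [MetricSpace X] [MeasurableSpace X] (μ : Measure X)
    (Cd CP lam : ℝ) : Prop where
  complete : CompleteSpace X
  nontrivial : Nontrivial X
  hCd : 1 ≤ Cd
  hCP : 0 < CP
  hlam : 1 ≤ lam
  doubling : ∀ (x : X) (r : ℝ), 0 < r →
    0 < μ (Metric.ball x (2 * r)) ∧
    μ (Metric.ball x (2 * r)) ≤ ENNReal.ofReal Cd * μ (Metric.ball x r) ∧
    μ (Metric.ball x r) < ⊤
  poincare : ∀ (x : X) (r : ℝ), 0 < r → ∀ u : X → ℝ, MeasureTheory.LocallyIntegrable u μ →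
    ∀ g : X → ℝ≥0∞, Measurable g → IsUpperGradientOn g u Set.univ →
      ∫⁻ y in Metric.ball x r, ENNReal.ofReal |u y - ⨍ z in Metric.ball x r, u z ∂μ| ∂μ ≤
        ENNReal.ofReal (CP * r) * (μ (Metric.ball x r) / μ (Metric.ball x (lam * r))) *
          ∫⁻ y in Metric.ball x (lam * r), g y ∂μ

set_option linter.unusedSectionVars false

lemma curveIntegral_mono {g g' : X → ℝ≥0∞} (h : ∀ x, g x ≤ g' x) (γ : Curve X) :
    curveIntegral g γ ≤ curveIntegral g' γ :=
  lintegral_mono fun _ => mul_le_mul_left (h _) _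

lemma sum_curveIntegral_le (ρ : ℕ → X → ℝ≥0∞) (γ : Curve X) (N : ℕ) :
    ∑ n ∈ Finset.range N, curveIntegral (ρ n) γ ≤
      curveIntegral (fun x => ∑ n ∈ Finset.range N, ρ n x) γ := by
  induction N with
  | zero => simp
  | succ N ih =>
    rw [Finset.sum_range_succ]
    refine (add_le_add_left ih _).trans ((le_lintegral_add _ _).trans (lintegral_mono fun t => ?_))
    simp only [Finset.sum_range_succ, add_mul]
    exact le_rfl

/-- A family of curves of zero modulus is negligible for an arbitrarily small density. -/
lemma exists_density_eq_top_of_mod1_eq_zero {μ : Measure X} {Γ : Set (Curve X)}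
    (hΓ : Mod1 μ Γ = 0) {ε : ℝ≥0∞} (hε : ε ≠ 0) :
    ∃ ρ : X → ℝ≥0∞, Measurable ρ ∧ (∀ γ ∈ Γ, curveIntegral ρ γ = ⊤) ∧ ∫⁻ x, ρ x ∂μ ≤ ε := by
  obtain ⟨δ, hδ, hsum⟩ := ENNReal.exists_pos_sum_of_countable' hε ℕ
  have h : ∀ n, ∃ ρ : X → ℝ≥0∞, Measurable ρ ∧ (∀ γ ∈ Γ, 1 ≤ curveIntegral ρ γ) ∧
      ∫⁻ x, ρ x ∂μ < δ n := fun n => by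
    have := hδ n
    rw [← hΓ, Mod1] at this
    simpa only [iInf_lt_iff, exists_prop] using this
  choose ρ hm h1 hi using h
  refine ⟨fun x => ∑' n, ρ n x, Measurable.tsum hm, fun γ hγ => ?_, ?_⟩
  · refine ENNReal.eq_top_of_forall_nnreal_le fun r => ?_
    obtain ⟨N, hN⟩ := exists_nat_ge r
    calc (r : ℝ≥0∞) ≤ ∑ n ∈ Finset.range N, (1 : ℝ≥0∞) := by simpa using mod_cast hN
      _ ≤ ∑ n ∈ Finset.range N, curveIntegral (ρ n) γ := Finset.sum_le_sum fun n _ => h1 n γ hγ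
      _ ≤ _ := sum_curveIntegral_le ρ γ N
      _ ≤ _ := curveIntegral_mono (fun x => ENNReal.sum_le_tsum _) γ
  · rw [lintegral_tsum fun n => (hm n).aemeasurable]
    exact (ENNReal.tsum_le_tsum fun n => (hi n).le).trans hsum.le

lemma IsWeakUpperGradientOn.exists_isUpperGradientOn {μ : Measure X} {g : X → ℝ≥0∞} {u : X → ℝ}
    {Ω : Set X} (h : IsWeakUpperGradientOn μ g u Ω) (hg : Measurable g) {ε : ℝ≥0∞} (hε : ε ≠ 0) :
    ∃ g' : X → ℝ≥0∞, Measurable g' ∧ IsUpperGradientOn g' u Ω ∧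
      ∫⁻ x, g' x ∂μ ≤ ∫⁻ x, g x ∂μ + ε := by
  obtain ⟨Γ, hΓ, hu⟩ := h
  obtain ⟨ρ, hρ, htop, hint⟩ := exists_density_eq_top_of_mod1_eq_zero hΓ hε
  refine ⟨fun x => g x + ρ x, hg.add hρ, fun γ hγ => ?_, ?_⟩
  · by_cases hmem : γ ∈ Γ
    · refine le_top.trans ((htop γ hmem).symm.le.trans (curveIntegral_mono (fun x => ?_) γ))
      exact le_add_self
    · exact (hu γ hmem hγ).trans (curveIntegral_mono (fun x => le_self_add) γ)
  · rw [lintegral_add_left hg]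
    gcongr

lemma IsUpperGradientOn.isWeakUpperGradientOn (μ : Measure X) {g : X → ℝ≥0∞} {u : X → ℝ}
    {Ω : Set X} (h : IsUpperGradientOn g u Ω) : IsWeakUpperGradientOn μ g u Ω := by
  refine ⟨∅, le_antisymm ?_ zero_le, fun γ _ hγ => h γ hγ⟩
  refine (iInf₂_le (fun _ => 0) measurable_const).trans ?_
  simp

/-- The speed of a curve at an interior time is at most its Lipschitz constant nearby. -/
lemma speed_le_of_eventually {γ : ℝ → X} {t : ℝ} {C : ℝ≥0}
    (h : ∀ᶠ s in 𝓝 t, dist (γ s) (γ t) ≤ C * |s - t|) : speed γ t ≤ C := by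
  refine limsup_le_of_le (by isBoundedDefault) ?_
  have h0 : Tendsto (fun s : ℝ => t + s) (𝓝[≠] 0) (𝓝 t) := by
    have : Tendsto (fun s : ℝ => t + s) (𝓝 0) (𝓝 (t + 0)) := (continuous_const_add t).tendsto 0
    rw [add_zero] at this
    exact this.mono_left nhdsWithin_le_nhds
  filter_upwards [h0.eventually h, self_mem_nhdsWithin] with s hs hs0
  have hs0 : 0 < |s| := abs_pos.2 hs0
  rw [← ENNReal.ofReal_coe_nnreal]
  refine ENNReal.ofReal_le_ofReal ?_
  rw [div_le_iff₀ hs0]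
  simpa using hs

lemma speed_le_of_lipschitzOnWith {γ : ℝ → X} {K : ℝ≥0} (h : LipschitzOnWith K γ (Icc 0 1))
    {t : ℝ} (ht : t ∈ Ioo (0 : ℝ) 1) : speed γ t ≤ K := by
  refine speed_le_of_eventually ?_
  filter_upwards [Ioo_mem_nhds ht.1 ht.2] with s hs
  have := h.dist_le_mul s (Ioo_subset_Icc_self hs) t (Ioo_subset_Icc_self ht)
  rwa [Real.dist_eq] at this

/-- If the pointwise Lipschitz constant of a locally Lipschitz function is bounded by `G`, then
the speed of the composition along a curve is controlled. -/
lemma enorm_deriv_comp_le {f : X → ℝ} {γ : ℝ → X} {t : ℝ} {G : ℝ≥0}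
    (hγ : ContinuousAt γ t) (hs : speed γ t ≠ ⊤)
    (hG : ∀ M : ℝ≥0, G < M → ∀ᶠ z in 𝓝 (γ t), |f z - f (γ t)| ≤ M * dist z (γ t))
    (hd : DifferentiableAt ℝ (fun s => f (γ s)) t) :
    ‖deriv (fun s => f (γ s)) t‖ₑ ≤ G * speed γ t := by
  have key : ∀ M : ℝ≥0, G < M → ‖deriv (fun s => f (γ s)) t‖ₑ ≤ M * speed γ t := by
    intro M hM
    have h0 : Tendsto (fun s : ℝ => t + s) (𝓝[≠] 0) (𝓝 t) := by
      have : Tendsto (fun s : ℝ => t + s) (𝓝 0) (𝓝 (t + 0)) := (continuous_const_add t).tendsto 0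
      rw [add_zero] at this
      exact this.mono_left nhdsWithin_le_nhds
    have h1 := (hd.hasDerivAt.tendsto_slope_zero).enorm
    rw [speed, ← ENNReal.limsup_const_mul_of_ne_top ENNReal.coe_ne_top, ← h1.limsup_eq]
    refine limsup_le_limsup ?_
    filter_upwards [(hγ.tendsto.comp h0).eventually (hG M hM), self_mem_nhdsWithin] with s hs hs0
    have hs0 : 0 < |s| := abs_pos.2 hs0
    rw [← ENNReal.ofReal_coe_nnreal, ← ENNReal.ofReal_mul M.coe_nonneg, Real.enorm_eq_ofReal_abs]
    refine ENNReal.ofReal_le_ofReal ?_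
    rw [smul_eq_mul, abs_mul, abs_inv, inv_mul_eq_div, mul_div_assoc']
    gcongr
    exact hs
  have hlim : Tendsto (fun M : ℝ≥0 => (M : ℝ≥0∞) * speed γ t) (𝓝[>] G) (𝓝 (G * speed γ t)) :=
    ENNReal.Tendsto.mul_const ((ENNReal.continuous_coe.tendsto G).mono_left nhdsWithin_le_nhds)
      (Or.inr hs)
  exact ge_of_tendsto hlim (eventually_mem_nhdsWithin.mono fun M hM => key M hM)

lemma Curve.isCompact_image (γ : Curve X) : IsCompact (γ.toFun '' Icc 0 1) := by
  obtain ⟨K, hK⟩ := γ.lipschitz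
  exact isCompact_Icc.image_of_continuousOn hK.continuousOn

lemma LocLipschitzOn.exists_lipschitzOnWith_comp {f : X → ℝ} (hf : LocLipschitzOn f univ)
    (γ : Curve X) : ∃ K : ℝ≥0, LipschitzOnWith K (fun t => f (γ.toFun t)) (Icc 0 1) := by
  obtain ⟨K, hK⟩ := γ.lipschitz
  obtain ⟨C, hC⟩ := hf _ γ.isCompact_image (subset_univ _)
  exact ⟨C * K, hC.comp hK (mapsTo_image _ _)⟩

/-- A bound for the pointwise Lipschitz constant is an upper gradient. -/
lemma isUpperGradientOn_of_pointwise {f : X → ℝ} (hf : LocLipschitzOn f univ) {G : X → ℝ≥0}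
    (hG : ∀ y, ∀ M : ℝ≥0, G y < M → ∀ᶠ z in 𝓝 y, |f z - f y| ≤ M * dist z y) :
    IsUpperGradientOn (fun y => (G y : ℝ≥0∞)) f univ := by
  intro γ _
  obtain ⟨K, hK⟩ := γ.lipschitz
  obtain ⟨C, hC⟩ := hf.exists_lipschitzOnWith_comp γ
  have hac : AbsolutelyContinuousOnInterval (fun t => f (γ.toFun t)) 0 1 := by
    apply LipschitzOnWith.absolutelyContinuousOnInterval (K := C)
    rwa [uIcc_of_le zero_le_one]
  have hae := hac.ae_differentiableAt
  rw [← hac.integral_deriv_eq_sub, intervalIntegral.integral_of_le zero_le_one,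
    ← Real.enorm_eq_ofReal_abs]
  refine (enorm_integral_le_lintegral_enorm _).trans ?_
  rw [curveIntegral, ← restrict_Ioo_eq_restrict_Ioc, ← restrict_Ioo_eq_restrict_Icc]
  refine lintegral_mono_ae ?_
  filter_upwards [ae_restrict_of_ae hae, ae_restrict_mem measurableSet_Ioo] with t ht ht01
  refine enorm_deriv_comp_le ?_ ?_ (hG _) (ht (by
    rw [uIcc_of_le zero_le_one]; exact Ioo_subset_Icc_self ht01))
  · exact hK.continuousOn.continuousAt (Icc_mem_nhds ht01.1 ht01.2)
  · exact ne_top_of_le_ne_top ENNReal.coe_ne_top (speed_le_of_lipschitzOnWith hK ht01)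

lemma speed_comp_affine_le (γ : ℝ → X) {c : ℝ} (hc : 0 < c) (a t : ℝ) :
    speed (fun s => γ (a + c * s)) t ≤ ENNReal.ofReal c * speed γ (a + c * t) := by
  have hm : Tendsto (fun h : ℝ => c * h) (𝓝[≠] 0) (𝓝[≠] 0) := by
    refine tendsto_nhdsWithin_of_tendsto_nhds_of_eventually_within _ ?_ ?_
    · have : Tendsto (fun h : ℝ => c * h) (𝓝 0) (𝓝 (c * 0)) := (continuous_const_mul c).tendsto 0
      rw [mul_zero] at this
      exact this.mono_left nhdsWithin_le_nhds
    · filter_upwards [self_mem_nhdsWithin] with h hh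
      exact mul_ne_zero hc.ne' hh
  rw [speed, speed, ← ENNReal.limsup_const_mul_of_ne_top ENNReal.ofReal_ne_top]
  refine le_trans (le_of_eq ?_) (limsup_le_limsup_of_le hm (by isBoundedDefault))
  rw [← limsup_comp]
  congr 1
  ext h
  simp only [Function.comp]
  rw [← ENNReal.ofReal_mul hc.le, abs_mul, abs_of_pos hc]
  congr 1
  rw [show a + c * (t + h) = a + c * t + c * h by ring]
  field_simp

/-- The upper gradient inequality on a subcurve. -/
lemma IsUpperGradientOn.subcurve {g : X → ℝ≥0∞} {u : X → ℝ} (h : IsUpperGradientOn g u univ)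
    (γ : Curve X) {a b : ℝ} (ha : 0 ≤ a) (hab : a ≤ b) (hb : b ≤ 1) :
    ENNReal.ofReal |u (γ.toFun b) - u (γ.toFun a)| ≤
      ∫⁻ t in Ioo a b, g (γ.toFun t) * speed γ.toFun t := by
  rcases hab.eq_or_lt with rfl | hab
  · simp
  have hc : 0 < b - a := sub_pos.2 hab
  obtain ⟨K, hK⟩ := γ.lipschitz
  have hmaps : MapsTo (fun s : ℝ => a + (b - a) * s) (Icc 0 1) (Icc 0 1) := fun s hs => by
    constructor <;> nlinarith [hs.1, hs.2]
  let γ' : Curve X := ⟨fun s => γ.toFun (a + (b - a) * s), K * (b - a).toNNReal, by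
    refine hK.comp (LipschitzWith.lipschitzOnWith (LipschitzWith.of_dist_le_mul fun s t => ?_)) hmaps
    rw [Real.dist_eq, Real.dist_eq, Real.coe_toNNReal _ hc.le,
      show a + (b - a) * s - (a + (b - a) * t) = (b - a) * (s - t) by ring, abs_mul,
      abs_of_pos hc]⟩
  have h1 := h γ' fun _ _ => mem_univ _
  simp only [γ', mul_one, mul_zero, add_zero, add_sub_cancel] at h1
  refine h1.trans ?_
  have himg : (fun s : ℝ => a + (b - a) * s) '' Icc 0 1 = Icc a b := by
    have := image_affine_Icc' hc a 0 1
    simp only [mul_zero, zero_add, mul_one, sub_add_cancel] at this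
    rw [← this]
    exact image_congr fun s _ => add_comm _ _
  rw [restrict_Ioo_eq_restrict_Icc, ← himg,
    lintegral_image_eq_lintegral_abs_deriv_mul (f' := fun _ => b - a) measurableSet_Icc]
  · refine lintegral_mono fun t => ?_
    refine (mul_le_mul_right (speed_comp_affine_le γ.toFun hc a t) _).trans_eq ?_
    simp only [abs_of_pos hc]
    ring
  · intro s _
    simpa using (((hasDerivAt_id s).const_mul (b - a)).const_add a).hasDerivWithinAt
  · intro s _ t _ hst
    simpa [hc.ne'] using hst

/-- A change of `min φ c` on an interval is bounded by a change of `φ` on a subinterval in which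
`φ < c`. -/
lemma exists_subinterval_lt {φ : ℝ → ℝ} (hφ : ContinuousOn φ (Icc 0 1)) (c : ℝ) :
    ∃ a b : ℝ, 0 ≤ a ∧ a ≤ b ∧ b ≤ 1 ∧ (∀ t ∈ Ioo a b, φ t < c) ∧
      |min (φ 1) c - min (φ 0) c| ≤ |φ b - φ a| := by
  have h0 : (0 : ℝ) ∈ Icc (0 : ℝ) 1 := by simp
  have h1 : (1 : ℝ) ∈ Icc (0 : ℝ) 1 := by simp
  rcases le_total (φ 0) (φ 1) with hle | hle
  · have hcl : IsCompact (Icc 0 1 ∩ φ ⁻¹' Ici (min (φ 1) c)) :=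
      isCompact_Icc.of_isClosed_subset (hφ.preimage_isClosed_of_isClosed isClosed_Icc isClosed_Ici)
        inter_subset_left
    obtain ⟨b, ⟨hb, hbφ⟩, hleast⟩ := hcl.exists_isLeast ⟨1, h1, (min_le_left _ _ : min (φ 1) c ≤ φ 1)⟩
    refine ⟨0, b, le_rfl, hb.1, hb.2, fun t ht => ?_, ?_⟩
    · by_contra hcon
      exact absurd (hleast ⟨⟨ht.1.le, ht.2.le.trans hb.2⟩,
        (min_le_right _ _).trans (not_lt.1 hcon)⟩) (not_le.2 ht.2)
    · rw [abs_of_nonneg (sub_nonneg.2 (min_le_min_right c hle))]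
      rcases le_total (φ 0) c with h | h
      · rw [min_eq_left h]
        exact (sub_le_sub_right hbφ _).trans (le_abs_self _)
      · rw [min_eq_right h, min_eq_right (h.trans hle)]
        simp
  · have hcl : IsCompact (Icc 0 1 ∩ φ ⁻¹' Ici (min (φ 0) c)) :=
      isCompact_Icc.of_isClosed_subset (hφ.preimage_isClosed_of_isClosed isClosed_Icc isClosed_Ici)
        inter_subset_left
    obtain ⟨a, ⟨ha, haφ⟩, hgreatest⟩ := hcl.exists_isGreatest ⟨0, h0, (min_le_left _ _ : min (φ 0) c ≤ φ 0)⟩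
    refine ⟨a, 1, ha.1, ha.2, le_rfl, fun t ht => ?_, ?_⟩
    · by_contra hcon
      exact absurd (hgreatest ⟨⟨ha.1.trans ht.1.le, ht.2.le⟩,
        (min_le_right _ _).trans (not_lt.1 hcon)⟩) (not_le.2 ht.1)
    · rw [abs_sub_comm, abs_of_nonneg (sub_nonneg.2 (min_le_min_right c hle)), abs_sub_comm]
      rcases le_total (φ 1) c with h | h
      · rw [min_eq_left h]
        exact (sub_le_sub_right haφ _).trans (le_abs_self _)
      · rw [min_eq_right h, min_eq_right (h.trans hle)]
        simp

lemma IsUpperGradientOn.min_const {g : X → ℝ≥0∞} {u : X → ℝ} (h : IsUpperGradientOn g u univ)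
    (hu : LocLipschitzOn u univ) (c : ℝ) :
    IsUpperGradientOn ({x | u x < c}.indicator g) (fun x => min (u x) c) univ := by
  intro γ _
  obtain ⟨K, hK⟩ := hu.exists_lipschitzOnWith_comp γ
  obtain ⟨a, b, ha, hab, hb, hlt, hle⟩ := exists_subinterval_lt hK.continuousOn c
  refine (ENNReal.ofReal_le_ofReal hle).trans ((h.subcurve γ ha hab hb).trans ?_)
  refine (setLIntegral_mono' measurableSet_Ioo fun t ht => ?_).trans
    (lintegral_mono_set fun t ht => ⟨ha.trans ht.1.le, ht.2.le.trans hb⟩)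
  rw [indicator_of_mem (show γ.toFun t ∈ {x | u x < c} from hlt t ht)]

lemma IsUpperGradientOn.neg {g : X → ℝ≥0∞} {u : X → ℝ} {Ω : Set X} (h : IsUpperGradientOn g u Ω) :
    IsUpperGradientOn g (fun x => -u x) Ω := fun γ hγ => by
  have := h γ hγ
  rwa [abs_sub_comm, show u (γ.toFun 0) - u (γ.toFun 1) =
    -u (γ.toFun 1) - -u (γ.toFun 0) by ring] at this

/-- Post-composition with a `1`-Lipschitz function preserves upper gradients. -/
lemma IsUpperGradientOn.comp_of_abs_sub_le {g : X → ℝ≥0∞} {u : X → ℝ} {Ω : Set X}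
    (h : IsUpperGradientOn g u Ω) {F : ℝ → ℝ} (hF : ∀ s t, |F s - F t| ≤ |s - t|) :
    IsUpperGradientOn g (fun x => F (u x)) Ω := fun γ hγ =>
  (ENNReal.ofReal_le_ofReal (hF _ _)).trans (h γ hγ)

lemma LocLipschitzOn.comp_of_abs_sub_le {u : X → ℝ} {Ω : Set X}
    (h : LocLipschitzOn u Ω) {F : ℝ → ℝ} {C : ℝ≥0} (hF : ∀ s t, |F s - F t| ≤ C * |s - t|) :
    LocLipschitzOn (fun x => F (u x)) Ω := fun K hK hKΩ => by
  obtain ⟨L, hL⟩ := h K hK hKΩ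
  exact ⟨C * L, (LipschitzWith.of_dist_le_mul hF).comp_lipschitzOnWith hL⟩

lemma IsUpperGradientOn.sub_const_max {g : X → ℝ≥0∞} {u : X → ℝ} (h : IsUpperGradientOn g u univ)
    (hu : LocLipschitzOn u univ) (c : ℝ) :
    IsUpperGradientOn ({x | c < u x}.indicator g) (fun x => max (u x - c) 0) univ := by
  have h1 := (h.neg.min_const (hu.comp_of_abs_sub_le (F := fun s => -s) (C := 1) fun s t => by
    rw [NNReal.coe_one, one_mul, abs_sub_comm s t]; exact le_of_eq (by congr 1; ring)) (-c)).neg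
  have h2 : {x | -u x < -c} = {x | c < u x} := by ext x; simp
  rw [h2] at h1
  refine fun γ hγ => le_of_eq_of_le ?_ (h1 γ hγ)
  congr 2
  have : ∀ s : ℝ, max (s - c) 0 = -min (-s) (-c) - c := fun s => by
    rw [min_neg_neg, neg_neg, ← max_sub_sub_right, sub_self]
  simp only [this]
  ring


lemma MMS.measure_ball_pos {μ : Measure X} {Cd CP lam : ℝ} (h : MMS μ Cd CP lam) (x : X) {r : ℝ}
    (hr : 0 < r) : 0 < μ (ball x r) := by
  have := (h.doubling x (r / 2) (half_pos hr)).1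
  rwa [mul_div_cancel₀ _ (two_ne_zero' ℝ)] at this

lemma MMS.measure_ball_pow_le {μ : Measure X} {Cd CP lam : ℝ} (h : MMS μ Cd CP lam) (x : X) {r : ℝ}
    (hr : 0 < r) (n : ℕ) : μ (ball x (2 ^ n * r)) ≤ ENNReal.ofReal Cd ^ n * μ (ball x r) := by
  induction n with
  | zero => simp
  | succ n ih =>
    rw [pow_succ', pow_succ', mul_assoc, mul_assoc]
    exact (h.doubling x _ (by positivity)).2.1.trans (by gcongr)

lemma MMS.totallyBounded_ball [BorelSpace X] {μ : Measure X} {Cd CP lam : ℝ} (h : MMS μ Cd CP lam)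
    (x : X) (R : ℝ) : TotallyBounded (ball x R) := by
  rcases le_or_gt R 0 with hR | hR
  · rw [ball_eq_empty.2 hR]; exact totallyBounded_empty
  by_contra hnot
  rw [Metric.totallyBounded_iff] at hnot
  push Not at hnot
  obtain ⟨ε, hε, hcov⟩ := hnot
  obtain ⟨f, hfR, hfsep⟩ := exists_seq_of_forall_finset_exists (fun y => y ∈ ball x R)
    (fun y z => ε ≤ dist z y) (fun s _ => by
      obtain ⟨z, hz, hzs⟩ := not_subset.1 (hcov s s.finite_toSet)
      refine ⟨z, hz, fun y hy => ?_⟩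
      by_contra hlt
      exact hzs (mem_biUnion hy (mem_ball.2 (not_le.1 hlt))))
  have hsep : ∀ m n, m ≠ n → ε ≤ dist (f m) (f n) := fun m n hmn => by
    rcases hmn.lt_or_gt with hlt | hlt
    · rw [dist_comm]; exact hfsep m n hlt
    · exact hfsep n m hlt
  obtain ⟨k, hk⟩ := pow_unbounded_of_one_lt ((2 * R + ε) / (ε / 2)) (one_lt_two (α := ℝ))
  rw [div_lt_iff₀ (half_pos hε)] at hk
  have hlow : ∀ n, μ (ball x (R + ε)) ≤ ENNReal.ofReal Cd ^ k * μ (ball (f n) (ε / 2)) := fun n => by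
    refine (measure_mono fun y hy => ?_).trans (h.measure_ball_pow_le (f n) (half_pos hε) k)
    have h1 := mem_ball.1 (hfR n)
    have h2 := mem_ball.1 hy
    have h3 := dist_triangle_right y (f n) x
    exact mem_ball.2 (by linarith)
  have hdisj : Pairwise (Function.onFun Disjoint fun n => ball (f n) (ε / 2)) := fun m n hmn =>
    ball_disjoint_ball (by linarith [hsep m n hmn])
  have hsum : ∑' n, μ (ball (f n) (ε / 2)) ≤ μ (ball x (R + ε)) := by
    rw [← measure_iUnion hdisj fun n => isOpen_ball.measurableSet]
    refine measure_mono (iUnion_subset fun n => ball_subset_ball' ?_)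
    linarith [mem_ball.1 (hfR n)]
  have hfin : μ (ball x (R + ε)) < ⊤ := (h.doubling x _ (by positivity)).2.2
  have hpos := h.measure_ball_pos x (show 0 < R + ε by positivity)
  have htop : ∑' n : ℕ, μ (ball x (R + ε)) ≤ ENNReal.ofReal Cd ^ k * μ (ball x (R + ε)) := by
    refine (ENNReal.tsum_le_tsum hlow).trans ?_
    rw [ENNReal.tsum_mul_left]
    gcongr
  rw [ENNReal.tsum_const_eq_top_of_ne_zero hpos.ne'] at htop
  exact absurd (top_le_iff.1 htop)
    (ENNReal.mul_ne_top (ENNReal.pow_ne_top ENNReal.ofReal_ne_top) hfin.ne)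

lemma MMS.properSpace [BorelSpace X] {μ : Measure X} {Cd CP lam : ℝ} (h : MMS μ Cd CP lam) :
    ProperSpace X := by
  have := h.complete
  refine ⟨fun x r => isCompact_iff_totallyBounded_isComplete.2 ⟨?_, isClosed_closedBall.isComplete⟩⟩
  exact (h.totallyBounded_ball x (r + 1)).subset (closedBall_subset_ball (lt_add_one r))

lemma MMS.isLocallyFiniteMeasure {μ : Measure X} {Cd CP lam : ℝ} (h : MMS μ Cd CP lam) :
    IsLocallyFiniteMeasure μ :=
  ⟨fun x => ⟨ball x 1, ball_mem_nhds x one_pos, (h.doubling x 1 one_pos).2.2⟩⟩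

section

lemma LocLipschitzOn.continuous [ProperSpace X] {u : X → ℝ} (h : LocLipschitzOn u univ) :
    Continuous u := by
  refine continuous_iff_continuousAt.2 fun x => ?_
  obtain ⟨L, hL⟩ := h _ (isCompact_closedBall x 1) (subset_univ _)
  exact hL.continuousOn.continuousAt (closedBall_mem_nhds x one_pos)

lemma LocLipschitzOn.add {u v : X → ℝ} {Ω : Set X} (hu : LocLipschitzOn u Ω)
    (hv : LocLipschitzOn v Ω) : LocLipschitzOn (fun x => u x + v x) Ω := fun K hK hKΩ => by
  obtain ⟨L, hL⟩ := hu K hK hKΩ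
  obtain ⟨M, hM⟩ := hv K hK hKΩ
  exact ⟨L + M, hL.add hM⟩

lemma IsUpperGradientOn.add {g h : X → ℝ≥0∞} {u v : X → ℝ} {Ω : Set X}
    (hu : IsUpperGradientOn g u Ω) (hv : IsUpperGradientOn h v Ω) :
    IsUpperGradientOn (fun x => g x + h x) (fun x => u x + v x) Ω := fun γ hγ => by
  refine (ENNReal.ofReal_le_ofReal ?_).trans
    ((ENNReal.ofReal_add (abs_nonneg (u (γ.toFun 1) - u (γ.toFun 0)))
      (abs_nonneg (v (γ.toFun 1) - v (γ.toFun 0)))).le.trans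
    ((add_le_add (hu γ hγ) (hv γ hγ)).trans ((le_lintegral_add _ _).trans ?_)))
  · rw [add_sub_add_comm]; exact abs_add_le _ _
  · exact lintegral_mono fun t => by simp only [add_mul]; exact le_rfl

lemma IsUpperGradientOn.const_mul {g : X → ℝ≥0∞} {u : X → ℝ} {Ω : Set X}
    (hu : IsUpperGradientOn g u Ω) {a : ℝ} (ha : 0 ≤ a) :
    IsUpperGradientOn (fun x => ENNReal.ofReal a * g x) (fun x => a * u x) Ω := fun γ hγ => by
  rw [← mul_sub, abs_mul, abs_of_nonneg ha, ENNReal.ofReal_mul ha]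
  refine (mul_le_mul_right (hu γ hγ) _).trans ?_
  unfold curveIntegral
  rw [← lintegral_const_mul' _ _ ENNReal.ofReal_ne_top]
  exact lintegral_mono fun t => by simp only [mul_assoc]; exact le_rfl

/-- `v` is locally Lipschitz and has an upper gradient of integral at most `c`. -/
def HasEnergyLE (μ : Measure X) (v : X → ℝ) (c : ℝ≥0∞) : Prop :=
  LocLipschitzOn v univ ∧
    ∃ g : X → ℝ≥0∞, Measurable g ∧ IsUpperGradientOn g v univ ∧ ∫⁻ x, g x ∂μ ≤ c

lemma HasEnergyLE.add {μ : Measure X} {u v : X → ℝ} {c d : ℝ≥0∞} (hu : HasEnergyLE μ u c)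
    (hv : HasEnergyLE μ v d) : HasEnergyLE μ (fun x => u x + v x) (c + d) := by
  obtain ⟨hu, g, hg, hgu, hgc⟩ := hu
  obtain ⟨hv, k, hk, hkv, hkd⟩ := hv
  refine ⟨hu.add hv, _, hg.add hk, hgu.add hkv, ?_⟩
  simp only [Pi.add_apply]
  rw [lintegral_add_left hg]
  exact add_le_add hgc hkd

lemma HasEnergyLE.const_mul {μ : Measure X} {u : X → ℝ} {c : ℝ≥0∞} (hu : HasEnergyLE μ u c)
    {a : ℝ} (ha : 0 ≤ a) : HasEnergyLE μ (fun x => a * u x) (ENNReal.ofReal a * c) := by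
  obtain ⟨hu, g, hg, hgu, hgc⟩ := hu
  refine ⟨hu.comp_of_abs_sub_le (F := fun s => a * s) (C := ⟨a, ha⟩) fun s t => ?_,
    _, hg.const_mul _, hgu.const_mul ha, ?_⟩
  · rw [← mul_sub, abs_mul, abs_of_nonneg ha]; rfl
  · rw [lintegral_const_mul _ hg]
    gcongr

lemma HasEnergyLE.comp {μ : Measure X} {u : X → ℝ} {c : ℝ≥0∞} (hu : HasEnergyLE μ u c)
    {F : ℝ → ℝ} (hF : ∀ s t, |F s - F t| ≤ |s - t|) : HasEnergyLE μ (fun x => F (u x)) c := by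
  obtain ⟨hu, g, hg, hgu, hgc⟩ := hu
  exact ⟨hu.comp_of_abs_sub_le (C := 1) (by simpa using hF), g, hg, hgu.comp_of_abs_sub_le hF, hgc⟩

/-- `u` is a limit in `L¹` on compact sets of locally Lipschitz functions of energy at most `c`. -/
def Approximable (μ : Measure X) (c : ℝ≥0∞) (u : X → ℝ) : Prop :=
  ∀ K : Set X, IsCompact K → ∀ ε : ℝ≥0∞, ε ≠ 0 →
    ∃ v, HasEnergyLE μ v c ∧ ∫⁻ x in K, ENNReal.ofReal |v x - u x| ∂μ ≤ ε

lemma HasEnergyLE.approximable {μ : Measure X} {u : X → ℝ} {c : ℝ≥0∞} (hu : HasEnergyLE μ u c) :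
    Approximable μ c u := fun K _ ε _ => ⟨u, hu, by simp⟩

lemma Approximable.mono {μ : Measure X} {u : X → ℝ} {c d : ℝ≥0∞} (h : Approximable μ c u)
    (hcd : c ≤ d) : Approximable μ d u := fun K hK ε hε => by
  obtain ⟨v, ⟨hv, g, hg, hgv, hgc⟩, hvu⟩ := h K hK ε hε
  exact ⟨v, ⟨hv, g, hg, hgv, hgc.trans hcd⟩, hvu⟩

lemma Approximable.congr_ae {μ : Measure X} {u v : X → ℝ} {c : ℝ≥0∞} (h : Approximable μ c u)
    (huv : u =ᵐ[μ] v) : Approximable μ c v := fun K hK ε hε => by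
  obtain ⟨w, hw, hwu⟩ := h K hK ε hε
  refine ⟨w, hw, le_of_eq_of_le (lintegral_congr_ae ?_) hwu⟩
  filter_upwards [ae_restrict_of_ae huv] with x hx
  rw [hx]

lemma lintegral_abs_sub_comp_le {μ : Measure X} {F : ℝ → ℝ} (hF : ∀ s t, |F s - F t| ≤ |s - t|)
    (u v : X → ℝ) : ∫⁻ x, ENNReal.ofReal |F (v x) - F (u x)| ∂μ ≤
      ∫⁻ x, ENNReal.ofReal |v x - u x| ∂μ :=
  lintegral_mono fun _ => ENNReal.ofReal_le_ofReal (hF _ _)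

lemma Approximable.comp {μ : Measure X} {u : X → ℝ} {c : ℝ≥0∞} (h : Approximable μ c u)
    {F : ℝ → ℝ} (hF : ∀ s t, |F s - F t| ≤ |s - t|) : Approximable μ c (fun x => F (u x)) :=
  fun K hK ε hε => by
    obtain ⟨v, hv, hvu⟩ := h K hK ε hε
    exact ⟨_, hv.comp hF, (lintegral_abs_sub_comp_le hF u v).trans hvu⟩

lemma Approximable.const_mul {μ : Measure X} {u : X → ℝ} {c : ℝ≥0∞} (h : Approximable μ c u)
    {a : ℝ} (ha : 0 < a) : Approximable μ (ENNReal.ofReal a * c) (fun x => a * u x) :=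
  fun K hK ε hε => by
    have ha' : ENNReal.ofReal a ≠ 0 := (ENNReal.ofReal_pos.2 ha).ne'
    obtain ⟨v, hv, hvu⟩ := h K hK (ε / ENNReal.ofReal a)
      (ENNReal.div_ne_zero.2 ⟨hε, ENNReal.ofReal_ne_top⟩)
    refine ⟨_, hv.const_mul ha.le, ?_⟩
    simp only [← mul_sub, abs_mul, abs_of_pos ha, ENNReal.ofReal_mul ha.le]
    rw [lintegral_const_mul' _ _ ENNReal.ofReal_ne_top]
    refine (mul_le_mul_right hvu _).trans ?_
    rw [ENNReal.mul_div_cancel ha' ENNReal.ofReal_ne_top]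

lemma lintegral_abs_add_le {μ : Measure X} {f g : X → ℝ} (hf : AEMeasurable f μ) :
    ∫⁻ x, ENNReal.ofReal |f x + g x| ∂μ ≤
      ∫⁻ x, ENNReal.ofReal |f x| ∂μ + ∫⁻ x, ENNReal.ofReal |g x| ∂μ := by
  rw [← lintegral_add_left' (f := fun x => ENNReal.ofReal |f x|) (hf.norm.ennreal_ofReal)]
  refine lintegral_mono fun x => ?_
  rw [← ENNReal.ofReal_add (abs_nonneg _) (abs_nonneg _)]
  exact ENNReal.ofReal_le_ofReal (abs_add_le _ _)

variable [BorelSpace X] [ProperSpace X]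

lemma HasEnergyLE.measurable {μ : Measure X} {v : X → ℝ} {c : ℝ≥0∞} (h : HasEnergyLE μ v c) :
    Measurable v := h.1.continuous.measurable

lemma Approximable.add {μ : Measure X} {u v : X → ℝ} {c d : ℝ≥0∞} (hu : Approximable μ c u)
    (hv : Approximable μ d v) (hum : AEMeasurable u μ) :
    Approximable μ (c + d) (fun x => u x + v x) := fun K hK ε hε => by
  obtain ⟨u', hu', hu'u⟩ := hu K hK (ε / 2) (ENNReal.half_pos hε).ne'
  obtain ⟨v', hv', hv'v⟩ := hv K hK (ε / 2) (ENNReal.half_pos hε).ne'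
  refine ⟨_, hu'.add hv', ?_⟩
  simp only [add_sub_add_comm]
  refine (lintegral_abs_add_le (hu'.measurable.aemeasurable.sub hum.restrict)).trans ?_
  exact (add_le_add hu'u hv'v).trans (ENNReal.add_halves ε).le

lemma Approximable.of_forall_exists {μ : Measure X} {u : X → ℝ} {c : ℝ≥0∞}
    (h : ∀ K : Set X, IsCompact K → ∀ ε : ℝ≥0∞, ε ≠ 0 → ∃ w, AEMeasurable w μ ∧
      Approximable μ c w ∧ ∫⁻ x in K, ENNReal.ofReal |w x - u x| ∂μ ≤ ε) :
    Approximable μ c u := fun K hK ε hε => by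
  obtain ⟨w, hwm, hw, hwu⟩ := h K hK (ε / 2) (ENNReal.half_pos hε).ne'
  obtain ⟨v, hv, hvw⟩ := hw K hK (ε / 2) (ENNReal.half_pos hε).ne'
  refine ⟨v, hv, ?_⟩
  refine (lintegral_mono fun x => ?_).trans ((lintegral_abs_add_le (f := fun x => v x - w x)
    (g := fun x => w x - u x) (hv.measurable.aemeasurable.sub hwm.restrict)).trans
    ((add_le_add hvw hwu).trans (ENNReal.add_halves ε).le))
  rw [sub_add_sub_cancel]

lemma tv_univ_le_liminf {μ : Measure X} {u : X → ℝ} {v : ℕ → X → ℝ} {g : ℕ → X → ℝ≥0∞}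
    (hv : ∀ i, LocLipschitzOn (v i) univ) (hvu : TendstoL1Loc μ v u univ)
    (hg : ∀ i, Measurable (g i)) (hgv : ∀ i, IsUpperGradientOn (g i) (v i) univ) :
    tv μ u univ ≤ liminf (fun i => ∫⁻ x, g i x ∂μ) atTop := by
  refine (iInf₂_le v hv).trans ((iInf₂_le hvu g).trans ((iInf₂_le hg fun i =>
    (hgv i).isWeakUpperGradientOn μ).trans ?_))
  simp only [Measure.restrict_univ]
  exact le_rfl

lemma Approximable.exists_seq {μ : Measure X} {u : X → ℝ} {c : ℝ≥0∞} (h : Approximable μ c u) :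
    ∃ v : ℕ → X → ℝ, (∀ i, HasEnergyLE μ (v i) c) ∧ TendstoL1Loc μ v u univ := by
  have K := CompactExhaustion.choice X
  choose v hv hvu using fun n : ℕ => h (K n) (K.isCompact n) ((n : ℝ≥0∞)⁻¹)
    (ENNReal.inv_ne_zero.2 (ENNReal.natCast_ne_top n))
  refine ⟨v, hv, fun S hS _ => ?_⟩
  obtain ⟨N, hN⟩ := K.exists_superset_of_isCompact hS
  refine tendsto_of_tendsto_of_tendsto_of_le_of_le' tendsto_const_nhds
    ENNReal.tendsto_inv_nat_nhds_zero (Eventually.of_forall fun _ => zero_le) ?_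
  filter_upwards [eventually_ge_atTop N] with n hn
  exact (lintegral_mono_set (hN.trans (K.subset hn))).trans (hvu n)

lemma Approximable.tv_le {μ : Measure X} {u : X → ℝ} {c : ℝ≥0∞} (h : Approximable μ c u) :
    tv μ u univ ≤ c := by
  obtain ⟨v, hv, hvu⟩ := h.exists_seq
  choose hv g hg hgv hgc using hv
  exact (tv_univ_le_liminf hv hvu hg hgv).trans
    (liminf_le_of_le (by isBoundedDefault) fun b hb => by
      obtain ⟨n, hn⟩ := hb.exists
      exact hn.trans (hgc n))

lemma approximable_of_tv_lt {μ : Measure X} {u : X → ℝ} {c : ℝ≥0∞} (h : tv μ u univ < c) :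
    Approximable μ c u := fun K hK ε hε => by
  simp only [tv, iInf_lt_iff] at h
  obtain ⟨v, hv, hvu, g, hg, hgv, hlt⟩ := h
  simp only [Measure.restrict_univ] at hlt
  have hev := ENNReal.tendsto_nhds_zero.1 (hvu K hK (subset_univ _)) ε (pos_iff_ne_zero.2 hε)
  obtain ⟨n, hn, hnε⟩ := ((frequently_lt_of_liminf_lt (by isBoundedDefault) hlt).and_eventually
    hev).exists
  obtain ⟨g', hg', hgv', hint⟩ := (hgv n).exists_isUpperGradientOn (hg n)
    (tsub_pos_iff_lt.2 hn).ne'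
  exact ⟨v n, ⟨hv n, g', hg', hgv', hint.trans (add_tsub_cancel_of_le hn.le).le⟩, hnε⟩

lemma tv_le_of_forall_approximable {μ : Measure X} {u w : X → ℝ}
    (h : ∀ c, Approximable μ c u → Approximable μ c w) : tv μ w univ ≤ tv μ u univ :=
  le_of_forall_gt_imp_ge_of_dense fun c hc => (h c (approximable_of_tv_lt hc)).tv_le

lemma tv_comp_le {μ : Measure X} (u : X → ℝ) {F : ℝ → ℝ} (hF : ∀ s t, |F s - F t| ≤ |s - t|) :
    tv μ (fun x => F (u x)) univ ≤ tv μ u univ :=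
  tv_le_of_forall_approximable fun _ hc => hc.comp hF

lemma tv_const_mul_le {μ : Measure X} (u : X → ℝ) {a : ℝ} (ha : 0 < a) :
    tv μ (fun x => a * u x) univ ≤ ENNReal.ofReal a * tv μ u univ := by
  have ha' : ENNReal.ofReal a ≠ 0 := (ENNReal.ofReal_pos.2 ha).ne'
  rw [mul_comm, ← ENNReal.div_le_iff ha' ENNReal.ofReal_ne_top]
  refine le_of_forall_gt_imp_ge_of_dense fun c hc => ?_
  rw [ENNReal.div_le_iff ha' ENNReal.ofReal_ne_top, mul_comm]
  exact ((approximable_of_tv_lt hc).const_mul ha).tv_le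

lemma TendstoL1Loc.comp {μ : Measure X} {v : ℕ → X → ℝ} {u : X → ℝ} {Ω : Set X}
    (h : TendstoL1Loc μ v u Ω) {F : ℝ → ℝ} (hF : ∀ s t, |F s - F t| ≤ |s - t|) :
    TendstoL1Loc μ (fun i x => F (v i x)) (fun x => F (u x)) Ω := fun K hK hKΩ =>
  tendsto_of_tendsto_of_tendsto_of_le_of_le tendsto_const_nhds (h K hK hKΩ)
    (fun _ => zero_le) fun i => lintegral_abs_sub_comp_le hF u (v i)

lemma lintegral_indicator_lt_add_indicator_gt_le {μ : Measure X} {v : X → ℝ} (hv : Measurable v)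
    {g : X → ℝ≥0∞} (hg : Measurable g) (c : ℝ) :
    ∫⁻ x, {x | v x < c}.indicator g x ∂μ + ∫⁻ x, {x | c < v x}.indicator g x ∂μ ≤
      ∫⁻ x, g x ∂μ := by
  rw [← lintegral_add_left (hg.indicator (measurableSet_lt hv measurable_const))]
  refine lintegral_mono fun x => ?_
  rcases lt_trichotomy (v x) c with h | h | h
  · simp [indicator, h, h.not_gt]
  · simp [indicator, h]
  · simp [indicator, h, h.not_gt]

lemma liminf_add_liminf_le {a b : ℕ → ℝ≥0∞} {C : ℝ≥0∞} (h : ∀ i, a i + b i ≤ C) :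
    liminf a atTop + liminf b atTop ≤ C := by
  rw [liminf_eq_iSup_iInf_of_nat, liminf_eq_iSup_iInf_of_nat,
    ENNReal.iSup_add_iSup_of_monotone]
  · exact iSup_le fun n => (add_le_add (iInf₂_le n le_rfl) (iInf₂_le n le_rfl)).trans (h n)
  · exact fun m n hmn => le_iInf₂ fun i hi => iInf₂_le i (hmn.trans hi)
  · exact fun m n hmn => le_iInf₂ fun i hi => iInf₂_le i (hmn.trans hi)

lemma abs_min_const_sub_le (c s t : ℝ) : |min s c - min t c| ≤ |s - t| :=
  (abs_min_sub_min_le_max s c t c).trans (by simp)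

lemma abs_max_sub_const_sub_le (c s t : ℝ) : |max (s - c) 0 - max (t - c) 0| ≤ |s - t| :=
  (abs_max_sub_max_le_max (s - c) 0 (t - c) 0).trans (by simp)

lemma tv_min_const_le_liminf {μ : Measure X} {u : X → ℝ} {v : ℕ → X → ℝ} {g : ℕ → X → ℝ≥0∞}
    (hv : ∀ i, LocLipschitzOn (v i) univ) (hvu : TendstoL1Loc μ v u univ)
    (hg : ∀ i, Measurable (g i)) (hgv : ∀ i, IsUpperGradientOn (g i) (v i) univ) (c : ℝ) :
    tv μ (fun x => min (u x) c) univ ≤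
      liminf (fun i => ∫⁻ x, {x | v i x < c}.indicator (g i) x ∂μ) atTop := by
  refine tv_univ_le_liminf (v := fun i x => min (v i x) c) (fun i => ?_) ?_ (fun i => ?_)
    fun i => (hgv i).min_const (hv i) c
  · refine (hv i).comp_of_abs_sub_le (F := fun s => min s c) (C := 1) fun s t => ?_
    rw [NNReal.coe_one, one_mul]
    exact abs_min_const_sub_le c s t
  · exact hvu.comp (abs_min_const_sub_le c)
  · exact (hg i).indicator (measurableSet_lt (hv i).continuous.measurable measurable_const)

lemma tv_max_sub_const_le_liminf {μ : Measure X} {u : X → ℝ} {v : ℕ → X → ℝ} {g : ℕ → X → ℝ≥0∞}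
    (hv : ∀ i, LocLipschitzOn (v i) univ) (hvu : TendstoL1Loc μ v u univ)
    (hg : ∀ i, Measurable (g i)) (hgv : ∀ i, IsUpperGradientOn (g i) (v i) univ) (c : ℝ) :
    tv μ (fun x => max (u x - c) 0) univ ≤
      liminf (fun i => ∫⁻ x, {x | c < v i x}.indicator (g i) x ∂μ) atTop := by
  refine tv_univ_le_liminf (v := fun i x => max (v i x - c) 0) (fun i => ?_) ?_ (fun i => ?_)
    fun i => (hgv i).sub_const_max (hv i) c
  · refine (hv i).comp_of_abs_sub_le (F := fun s => max (s - c) 0) (C := 1) fun s t => ?_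
    rw [NNReal.coe_one, one_mul]
    exact abs_max_sub_const_sub_le c s t
  · exact hvu.comp (abs_max_sub_const_sub_le c)
  · exact (hg i).indicator (measurableSet_lt measurable_const (hv i).continuous.measurable)

lemma tv_min_add_tv_max_le {μ : Measure X} (u : X → ℝ) (c : ℝ) :
    tv μ (fun x => min (u x) c) univ + tv μ (fun x => max (u x - c) 0) univ ≤ tv μ u univ := by
  refine le_of_forall_gt_imp_ge_of_dense fun C hC => ?_
  obtain ⟨v, hv, hvu⟩ := (approximable_of_tv_lt hC).exists_seq
  choose hv g hg hgv hgc using hv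
  refine (add_le_add (tv_min_const_le_liminf hv hvu hg hgv c)
    (tv_max_sub_const_le_liminf hv hvu hg hgv c)).trans (liminf_add_liminf_le fun i => ?_)
  exact (lintegral_indicator_lt_add_indicator_gt_le (hv i).continuous.measurable (hg i) c).trans
    (hgc i)

end

/-- A measurable path, defined for all times and stopped at `time`, which is `L`-Lipschitz up to
an error `h`. -/
structure ApproxPath (X : Type*) [MetricSpace X] [MeasurableSpace X] (L h : ℝ) where
  toFun : ℝ → X
  time : ℝ
  measurable : Measurable toFun
  time_nonneg : 0 ≤ time
  dist_le : ∀ s t, dist (toFun s) (toFun t) ≤ L * |s - t| + h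

/-- The cost of an approximate path for an initial cost `U` and a running cost `w`. -/
def ApproxPath.cost {L h : ℝ} (σ : ApproxPath X L h) (U : X → ℝ≥0∞) (w : X → ℝ≥0) : ℝ≥0∞ :=
  U (σ.toFun 0) + ∫⁻ s in Ico 0 σ.time, ENNReal.ofReal L * w (σ.toFun s)

/-- The path that stays at one point. -/
def ApproxPath.const {L h : ℝ} (hL : 0 ≤ L) (hh : 0 ≤ h) (y : X) : ApproxPath X L h where
  toFun _ := y
  time := 0
  measurable := measurable_const
  time_nonneg := le_rfl
  dist_le s t := by rw [dist_self]; positivity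

/-- Prolong a path by a jump to a point at distance at most `h`. -/
def ApproxPath.extend {L h : ℝ} (σ : ApproxPath X L h) (hL : 0 < L) (z : X)
    (hz : dist (σ.toFun σ.time) z ≤ h) : ApproxPath X L h where
  toFun s := if s < σ.time then σ.toFun s else
    if s < σ.time + dist (σ.toFun σ.time) z / L then σ.toFun σ.time else z
  time := σ.time + dist (σ.toFun σ.time) z / L
  measurable := Measurable.ite measurableSet_Iio σ.measurable
    (Measurable.ite measurableSet_Iio measurable_const measurable_const)
  time_nonneg := add_nonneg σ.time_nonneg (by positivity)
  dist_le := by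
    have hh : 0 ≤ h := dist_nonneg.trans hz
    have key : ∀ s t, s ≤ t → dist
        (if s < σ.time then σ.toFun s else
          if s < σ.time + dist (σ.toFun σ.time) z / L then σ.toFun σ.time else z)
        (if t < σ.time then σ.toFun t else
          if t < σ.time + dist (σ.toFun σ.time) z / L then σ.toFun σ.time else z) ≤
        L * |s - t| + h := by
      intro s t hst
      have hpos : 0 ≤ L * |s - t| + h := by positivity
      have hd : 0 ≤ dist (σ.toFun σ.time) z / L := by positivity
      have h1 := σ.dist_le s σ.time
      split_ifs with a b c d e f
      · exact σ.dist_le s t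
      · rw [abs_of_nonpos (by linarith)] at h1 ⊢
        exact h1.trans (by gcongr; linarith)
      · rw [abs_of_nonpos (by linarith)] at h1 ⊢
        have h2 : dist (σ.toFun σ.time) z = L * (dist (σ.toFun σ.time) z / L) := by field_simp
        have h3 : L * (σ.time + dist (σ.toFun σ.time) z / L) ≤ L * t :=
          mul_le_mul_of_nonneg_left (not_lt.1 c) hL.le
        refine (dist_triangle _ (σ.toFun σ.time) _).trans ?_
        nlinarith
      · exact absurd (hst.trans_lt ‹t < σ.time›) a
      · rwa [dist_self]
      · exact hz.trans (by linarith [show 0 ≤ L * |s - t| by positivity])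
      · exact absurd (hst.trans_lt ‹t < σ.time›) a
      · exact absurd (hst.trans_lt ‹t < σ.time + _›) ‹¬ s < σ.time + _›
      · rwa [dist_self]
    intro s t
    rcases le_total s t with hst | hst
    · exact key s t hst
    · rw [dist_comm, abs_sub_comm]
      exact key t s hst

lemma ApproxPath.extend_time {L h : ℝ} (σ : ApproxPath X L h) (hL : 0 < L) (z : X)
    (hz : dist (σ.toFun σ.time) z ≤ h) :
    (σ.extend hL z hz).toFun (σ.extend hL z hz).time = z := by
  have hd : 0 ≤ dist (σ.toFun σ.time) z / L := by positivity
  simp [ApproxPath.extend, hd.not_gt]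

lemma ApproxPath.extend_zero {L h : ℝ} (σ : ApproxPath X L h) (hL : 0 < L) (z : X)
    (hz : dist (σ.toFun σ.time) z ≤ h) : (σ.extend hL z hz).toFun 0 = σ.toFun 0 := by
  have hd : 0 ≤ dist (σ.toFun σ.time) z := dist_nonneg
  simp only [ApproxPath.extend]
  split_ifs with a b
  · rfl
  · rw [le_antisymm (not_lt.1 a) σ.time_nonneg]
  · have h0 := le_antisymm (not_lt.1 a) σ.time_nonneg
    rw [h0, zero_add, not_lt] at b
    have : dist (σ.toFun 0) z ≤ 0 := by
      rwa [div_le_iff₀ hL, zero_mul] at b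
    exact (dist_le_zero.1 this).symm

lemma ApproxPath.cost_extend_le {L h : ℝ} (σ : ApproxPath X L h) (hL : 0 < L) (z : X)
    (hz : dist (σ.toFun σ.time) z ≤ h) (U : X → ℝ≥0∞) (w : X → ℝ≥0) :
    (σ.extend hL z hz).cost U w ≤
      σ.cost U w + w (σ.toFun σ.time) * edist (σ.toFun σ.time) z := by
  have hd : 0 ≤ dist (σ.toFun σ.time) z / L := by positivity
  rw [ApproxPath.cost, ApproxPath.cost, σ.extend_zero, add_assoc]
  refine add_le_add le_rfl ?_
  have hI : Ico 0 (σ.extend hL z hz).time = Ico 0 σ.time ∪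
      Ico σ.time (σ.time + dist (σ.toFun σ.time) z / L) :=
    (Ico_union_Ico_eq_Ico σ.time_nonneg (le_add_of_nonneg_right hd)).symm
  rw [hI]
  refine (lintegral_union_le _ _ _).trans (add_le_add (le_of_eq ?_) (le_of_eq ?_))
  · refine setLIntegral_congr_fun measurableSet_Ico fun s hs => ?_
    simp only [ApproxPath.extend, if_pos hs.2]
  · rw [setLIntegral_congr_fun (g := fun _ => ENNReal.ofReal L * w (σ.toFun σ.time))
      measurableSet_Ico fun s hs => by
        simp only [ApproxPath.extend, if_neg hs.1.not_gt, if_pos hs.2]]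
    rw [setLIntegral_const, Real.volume_Ico, add_sub_cancel_left, mul_right_comm,
      ← ENNReal.ofReal_mul hL.le, mul_div_cancel₀ _ hL.ne', edist_dist, mul_comm]

/-- The least cost of an approximate path ending at a given point. -/
def chainInf (U : X → ℝ≥0∞) (w : X → ℝ≥0) (L h : ℝ) (y : X) : ℝ≥0∞ :=
  ⨅ (σ : ApproxPath X L h) (_ : σ.toFun σ.time = y), σ.cost U w

lemma chainInf_le {U : X → ℝ≥0∞} {w : X → ℝ≥0} {L h : ℝ} (hL : 0 ≤ L) (hh : 0 ≤ h) (y : X) :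
    chainInf U w L h y ≤ U y :=
  (iInf₂_le (f := fun (σ : ApproxPath X L h) (_ : σ.toFun σ.time = y) => σ.cost U w)
    (ApproxPath.const hL hh y) rfl).trans (by simp [ApproxPath.cost, ApproxPath.const])

lemma chainInf_le_add {U : X → ℝ≥0∞} {w : X → ℝ≥0} {L h : ℝ} (hL : 0 < L) {y z : X}
    (hyz : dist y z ≤ h) :
    chainInf U w L h z ≤ chainInf U w L h y + w y * edist y z := by
  simp only [chainInf, ENNReal.iInf_add]
  refine le_iInf₂ fun σ hσ => ?_
  subst hσ
  exact (iInf₂_le (σ.extend hL z hyz) (σ.extend_time hL z hyz)).trans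
    (σ.cost_extend_le hL z hyz U w)

/-- The truncation of `chainInf` at height one. -/
def chainFun (U : X → ℝ≥0∞) (w : X → ℝ≥0) (L h : ℝ) (y : X) : ℝ :=
  (min 1 (chainInf U w L h y)).toReal

lemma chainFun_nonneg (U : X → ℝ≥0∞) (w : X → ℝ≥0) (L h : ℝ) (y : X) :
    0 ≤ chainFun U w L h y := ENNReal.toReal_nonneg

lemma chainFun_le_one (U : X → ℝ≥0∞) (w : X → ℝ≥0) (L h : ℝ) (y : X) :
    chainFun U w L h y ≤ 1 :=
  ENNReal.toReal_mono ENNReal.one_ne_top (min_le_left _ _)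

lemma ofReal_chainFun (U : X → ℝ≥0∞) (w : X → ℝ≥0) (L h : ℝ) (y : X) :
    ENNReal.ofReal (chainFun U w L h y) = min 1 (chainInf U w L h y) :=
  ENNReal.ofReal_toReal (ne_top_of_le_ne_top ENNReal.one_ne_top (min_le_left _ _))

lemma ofReal_chainFun_le {U : X → ℝ≥0∞} {w : X → ℝ≥0} {L h : ℝ} (hL : 0 ≤ L) (hh : 0 ≤ h)
    (y : X) : ENNReal.ofReal (chainFun U w L h y) ≤ U y := by
  rw [ofReal_chainFun]
  exact (min_le_right _ _).trans (chainInf_le hL hh y)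

lemma chainFun_le_add {U : X → ℝ≥0∞} {w : X → ℝ≥0} {L h : ℝ} (hL : 0 < L) {y z : X}
    (hyz : dist y z ≤ h) :
    chainFun U w L h z ≤ chainFun U w L h y + w y * dist y z := by
  rw [← ENNReal.ofReal_le_ofReal_iff (add_nonneg (chainFun_nonneg _ _ _ _ _) (by positivity)),
    ENNReal.ofReal_add (chainFun_nonneg _ _ _ _ _) (by positivity), ofReal_chainFun,
    ofReal_chainFun, ENNReal.ofReal_mul (by positivity), ENNReal.ofReal_coe_nnreal, ← edist_dist,
    min_add]
  exact le_min ((min_le_left _ _).trans le_self_add)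
    ((min_le_right _ _).trans (chainInf_le_add hL hyz))

lemma locLipschitzOn_chainFun {U : X → ℝ≥0∞} {w : X → ℝ≥0} {L h : ℝ} (hL : 0 < L) (hh : 0 < h)
    {M : ℝ≥0} (hM : ∀ y, w y ≤ M) : LocLipschitzOn (chainFun U w L h) univ := by
  intro K _ _
  have key : ∀ y z, chainFun U w L h z ≤ chainFun U w L h y + (M + 1 / h) * dist y z := by
    intro y z
    have hd : 0 ≤ dist y z := dist_nonneg
    rcases le_or_gt (dist y z) h with hyz | hyz
    · refine (chainFun_le_add hL hyz).trans (add_le_add le_rfl ?_)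
      gcongr
      exact le_add_of_le_of_nonneg (hM y) (by positivity)
    · have h1 : 1 ≤ 1 / h * dist y z := by
        rw [one_div, ← div_eq_inv_mul, one_le_div hh]; exact hyz.le
      have := chainFun_le_one U w L h z
      have := chainFun_nonneg U w L h y
      nlinarith [show 0 ≤ (M : ℝ) * dist y z by positivity]
  refine ⟨⟨M + 1 / h, by positivity⟩, LipschitzOnWith.of_dist_le_mul fun y _ z _ => ?_⟩
  change _ ≤ (M + 1 / h) * dist y z
  rw [Real.dist_eq, abs_sub_le_iff]
  have h1 := key y z
  have h2 := key z y
  rw [dist_comm z y] at h2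
  constructor <;> linarith

lemma isUpperGradientOn_chainFun {U : X → ℝ≥0∞} {w : X → ℝ≥0} {L h : ℝ} (hL : 0 < L) (hh : 0 < h)
    {M : ℝ≥0} (hM : ∀ y, w y ≤ M) (hw : Continuous w) {S : Set X} (hS : IsClosed S)
    (hUS : ∀ y ∉ S, U y = 0) :
    IsUpperGradientOn (fun y => ((S.indicator w y : ℝ≥0) : ℝ≥0∞)) (chainFun U w L h) univ := by
  refine isUpperGradientOn_of_pointwise (locLipschitzOn_chainFun hL hh hM) fun y C hC => ?_
  by_cases hy : y ∈ S
  · rw [indicator_of_mem hy] at hC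
    filter_upwards [hw.continuousAt.eventually_lt continuousAt_const hC, ball_mem_nhds y hh]
      with z hz hzh
    have hd : 0 ≤ dist z y := dist_nonneg
    have h1 := chainFun_le_add (U := U) (w := w) hL (mem_ball.1 hzh).le
    have h2 := chainFun_le_add (U := U) (w := w) hL (mem_ball'.1 hzh).le
    rw [dist_comm y z] at h2
    have h3 : (w z : ℝ) ≤ C := by exact_mod_cast hz.le
    have h4 : (w y : ℝ) ≤ C := by exact_mod_cast hC.le
    rw [abs_sub_le_iff]
    constructor <;> nlinarith
  · have h0 : ∀ z ∉ S, chainFun U w L h z = 0 := fun z hz => by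
      have := ofReal_chainFun_le (U := U) (w := w) hL.le hh.le z
      rw [hUS z hz, nonpos_iff_eq_zero, ENNReal.ofReal_eq_zero] at this
      exact le_antisymm this (chainFun_nonneg _ _ _ _ _)
    filter_upwards [hS.isOpen_compl.mem_nhds hy] with z hz
    rw [h0 z hz, h0 y hy, sub_self, abs_zero]
    positivity

/-- Infimal convolution of the truncation of `g` at height `n` with `n` times the distance. -/
def infConv (g : X → ℝ≥0∞) (n : ℕ) (y : X) : ℝ≥0∞ :=
  ⨅ z, (min (g z) n + n * edist y z)

lemma infConv_le (g : X → ℝ≥0∞) (n : ℕ) (y : X) : infConv g n y ≤ min (g y) n :=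
  (iInf_le _ y).trans (by simp)

lemma infConv_ne_top (g : X → ℝ≥0∞) (n : ℕ) (y : X) : infConv g n y ≠ ⊤ :=
  ne_top_of_le_ne_top (ENNReal.natCast_ne_top n) ((infConv_le g n y).trans (min_le_right _ _))

lemma continuous_infConv (g : X → ℝ≥0∞) (n : ℕ) : Continuous (infConv g n) := by
  refine continuous_of_le_add_edist n (ENNReal.natCast_ne_top n) fun y y' => ?_
  simp only [infConv, ENNReal.iInf_add]
  refine le_iInf fun z => (iInf_le _ z).trans ?_
  rw [add_assoc, ← mul_add, add_comm (edist y' z)]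
  gcongr
  exact edist_triangle _ _ _

lemma le_liminf_infConv {g : X → ℝ≥0∞} (hg : LowerSemicontinuous g) {y : X} {v : ℕ → X}
    {n : ℕ → ℕ} (hv : Tendsto v atTop (𝓝 y)) (hn : Tendsto n atTop atTop) :
    g y ≤ liminf (fun k => infConv g (n k) (v k)) atTop := by
  refine le_of_forall_lt fun m hm => ?_
  obtain ⟨m', hmm', hm'⟩ := exists_between hm
  refine hmm'.trans_le (le_liminf_of_le (by isBoundedDefault) ?_)
  obtain ⟨r, hr, hball⟩ := Metric.eventually_nhds_iff_ball.1 (hg y m' hm')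
  have hr' : ENNReal.ofReal (r / 2) ≠ 0 := (ENNReal.ofReal_pos.2 (half_pos hr)).ne'
  obtain ⟨N₁, hN₁⟩ := ENNReal.exists_nat_gt hm'.ne_top
  obtain ⟨N₂, hN₂⟩ := ENNReal.exists_nat_mul_gt hr' hm'.ne_top
  filter_upwards [hn.eventually_ge_atTop N₁, hn.eventually_ge_atTop N₂,
    hv.eventually (ball_mem_nhds y (half_pos hr))] with k h1 h2 h3
  refine le_iInf fun z => ?_
  by_cases hz : z ∈ ball y r
  · exact (le_min (hball z hz).le (hN₁.le.trans (by exact_mod_cast h1))).trans le_self_add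
  · refine le_trans ?_ le_add_self
    refine hN₂.le.trans (mul_le_mul' (by exact_mod_cast h2) ?_)
    rw [edist_dist]
    refine ENNReal.ofReal_le_ofReal ?_
    have h4 := dist_triangle_left z y (v k)
    have h5 := mem_ball.1 h3
    have h6 := not_lt.1 (mt mem_ball.2 hz)
    linarith

/-- A version of the Arzelà–Ascoli theorem for maps that are Lipschitz up to errors tending
to zero. -/
lemma exists_subseq_tendsto_lipschitzWith {K : Set X} (hK : IsCompact K) {L : ℝ≥0}
    {τ : ℕ → ℝ → X} {h : ℕ → ℝ} (hτ : ∀ n s, τ n s ∈ K) (hh : Tendsto h atTop (𝓝 0))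
    (hdist : ∀ n s t, dist (τ n s) (τ n t) ≤ L * |s - t| + h n) :
    ∃ φ : ℕ → ℕ, StrictMono φ ∧ ∃ γ : ℝ → X, LipschitzWith L γ ∧
      ∀ s, Tendsto (fun k => τ (φ k) s) atTop (𝓝 (γ s)) := by
  obtain ⟨F, -, φ, hφ, hF⟩ := (isCompact_univ_pi fun _ : ℚ => hK).tendsto_subseq
    (x := fun (n : ℕ) (q : ℚ) => τ n (q : ℝ)) fun n => mem_univ_pi.2 fun q => hτ n q
  have hhφ := hh.comp hφ.tendsto_atTop
  have hconv : ∀ s : ℝ, ∃ y, Tendsto (fun k => τ (φ k) s) atTop (𝓝 y) := by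
    intro s
    have hcau : CauchySeq fun k => τ (φ k) s := by
      refine Metric.cauchySeq_iff'.2 fun ε hε => ?_
      have hδ : 0 < ε / (6 * (L + 1)) := by positivity
      obtain ⟨q, hq1, hq2⟩ := exists_rat_btwn (show s < s + ε / (6 * (L + 1)) by linarith)
      have hsq : |s - q| ≤ ε / (6 * (L + 1)) := by
        rw [abs_sub_comm, abs_of_pos (by linarith)]; linarith
      have hL : (L : ℝ) * |s - q| ≤ ε / 6 := by
        calc (L : ℝ) * |s - q| ≤ (L + 1) * (ε / (6 * (L + 1))) := by gcongr; linarith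
          _ = ε / 6 := by field_simp
      obtain ⟨N₂, hN₂⟩ := eventually_atTop.1
        (hhφ.eventually (gt_mem_nhds (show 0 < ε / 12 by positivity)))
      obtain ⟨N₃, hN₃⟩ := Metric.cauchySeq_iff.1 ((tendsto_pi_nhds.1 hF q).cauchySeq) (ε / 3)
        (by positivity)
      refine ⟨max N₂ N₃, fun k hk => ?_⟩
      have hk2 := hN₂ k ((le_max_left _ _).trans hk)
      have hk3 := hN₂ (max N₂ N₃) (le_max_left _ _)
      have hk4 := hN₃ k ((le_max_right _ _).trans hk) (max N₂ N₃) (le_max_right _ _)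
      have a1 := hdist (φ k) s q
      have a2 := hdist (φ (max N₂ N₃)) q s
      rw [abs_sub_comm] at a2
      simp only [Function.comp_apply] at hk2 hk3 hk4
      have := dist_triangle4 (τ (φ k) s) (τ (φ k) q) (τ (φ (max N₂ N₃)) q) (τ (φ (max N₂ N₃)) s)
      linarith
    obtain ⟨y, -, hy⟩ := cauchySeq_tendsto_of_isComplete hK.isComplete (fun k => hτ (φ k) s) hcau
    exact ⟨y, hy⟩
  choose γ hγ using hconv
  refine ⟨φ, hφ, γ, LipschitzWith.of_dist_le_mul fun s t => ?_, hγ⟩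
  have := le_of_tendsto_of_tendsto ((hγ s).dist (hγ t)) (tendsto_const_nhds.add hhφ)
    (Eventually.of_forall fun k => hdist (φ k) s t)
  simpa [Real.dist_eq] using this

/-- Continuous approximations from below, up to an additive constant, of `g`. -/
def reg (g : X → ℝ≥0∞) (δ : ℝ≥0) (n : ℕ) (y : X) : ℝ≥0 := (infConv g n y).toNNReal + δ

lemma coe_reg (g : X → ℝ≥0∞) (δ : ℝ≥0) (n : ℕ) (y : X) :
    (reg g δ n y : ℝ≥0∞) = infConv g n y + δ := by
  rw [reg, ENNReal.coe_add, ENNReal.coe_toNNReal (infConv_ne_top g n y)]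

lemma continuous_reg (g : X → ℝ≥0∞) (δ : ℝ≥0) (n : ℕ) : Continuous (reg g δ n) :=
  (ENNReal.continuousOn_toNNReal.comp_continuous (continuous_infConv g n)
    (infConv_ne_top g n)).add continuous_const

lemma le_reg (g : X → ℝ≥0∞) (δ : ℝ≥0) (n : ℕ) (y : X) : δ ≤ reg g δ n y := le_add_self

lemma reg_le_natCast_add (g : X → ℝ≥0∞) (δ : ℝ≥0) (n : ℕ) (y : X) : reg g δ n y ≤ n + δ := by
  rw [← ENNReal.coe_le_coe, coe_reg]
  push_cast
  exact add_le_add ((infConv_le g n y).trans (min_le_right _ _)) le_rfl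

lemma coe_reg_le (g : X → ℝ≥0∞) (δ : ℝ≥0) (n : ℕ) (y : X) : (reg g δ n y : ℝ≥0∞) ≤ g y + δ := by
  rw [coe_reg]
  exact add_le_add ((infConv_le g n y).trans (min_le_left _ _)) le_rfl

lemma le_liminf_comp {U : X → ℝ≥0∞} (hU : LowerSemicontinuous U) {y : X} {v : ℕ → X}
    (hv : Tendsto v atTop (𝓝 y)) : U y ≤ liminf (fun k => U (v k)) atTop := by
  refine le_of_forall_lt fun m hm => ?_
  obtain ⟨m', hmm', hm'⟩ := exists_between hm
  refine hmm'.trans_le (le_liminf_of_le (by isBoundedDefault) ?_)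
  filter_upwards [hv.eventually (hU y m' hm')] with k hk using hk.le

/-- The time parameter of an approximate path clamped to its domain. -/
def ApproxPath.clamp {L h : ℝ} (σ : ApproxPath X L h) (s : ℝ) : X :=
  σ.toFun (max 0 (min s σ.time))

lemma ApproxPath.measurable_clamp {L h : ℝ} (σ : ApproxPath X L h) : Measurable σ.clamp :=
  σ.measurable.comp (measurable_const.max (measurable_id.min measurable_const))

lemma ApproxPath.clamp_of_mem {L h : ℝ} (σ : ApproxPath X L h) {s : ℝ}
    (hs : s ∈ Icc 0 σ.time) : σ.clamp s = σ.toFun s := by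
  rw [ApproxPath.clamp, min_eq_left hs.2, max_eq_right hs.1]

lemma ApproxPath.clamp_of_time_le {L h : ℝ} (σ : ApproxPath X L h) {s : ℝ}
    (hs : σ.time ≤ s) : σ.clamp s = σ.toFun σ.time := by
  rw [ApproxPath.clamp, min_eq_right hs, max_eq_right σ.time_nonneg]

lemma ApproxPath.dist_clamp_le {L h : ℝ} (hL : 0 ≤ L) (σ : ApproxPath X L h) (s t : ℝ) :
    dist (σ.clamp s) (σ.clamp t) ≤ L * |s - t| + h := by
  refine (σ.dist_le _ _).trans (add_le_add (mul_le_mul_of_nonneg_left ?_ hL) le_rfl)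
  refine (abs_max_sub_max_le_max 0 (min s σ.time) 0 (min t σ.time)).trans ?_
  rw [sub_self, abs_zero, max_eq_right (abs_nonneg _)]
  refine (abs_min_sub_min_le_max s σ.time t σ.time).trans ?_
  simp

lemma ApproxPath.dist_clamp_end_le {L h : ℝ} (hL : 0 ≤ L) (σ : ApproxPath X L h)
    (hT : σ.time ≤ 1) (s : ℝ) : dist (σ.clamp s) (σ.toFun σ.time) ≤ L + h := by
  refine (σ.dist_le _ _).trans ?_
  gcongr
  refine mul_le_of_le_one_right hL (abs_le.2 ⟨?_, ?_⟩)
  · linarith [le_max_left 0 (min s σ.time)]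
  · have := σ.time_nonneg
    have : max 0 (min s σ.time) ≤ σ.time := max_le this (min_le_right _ _)
    linarith

lemma ApproxPath.ofReal_time_le_cost {L h : ℝ} (σ : ApproxPath X L h) {U : X → ℝ≥0∞}
    {w : X → ℝ≥0} (hw : ∀ y, 1 ≤ ENNReal.ofReal L * w y) : ENNReal.ofReal σ.time ≤ σ.cost U w := by
  refine le_trans ?_ le_add_self
  calc ENNReal.ofReal σ.time = ∫⁻ s in Ico 0 σ.time, 1 := by simp
    _ ≤ _ := lintegral_mono fun s => hw _

/-- Limits of approximate paths are curves whose cost is controlled. -/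
lemma ofReal_le_of_tendsto_approxPath [BorelSpace X] {u : X → ℝ} {g U : X → ℝ≥0∞}
    (hg : LowerSemicontinuous g) (hU : LowerSemicontinuous U) (hgu : IsUpperGradientOn g u univ)
    (huU : ∀ y, ENNReal.ofReal (u y) ≤ U y) {δ L : ℝ≥0} {h : ℕ → ℝ} {n : ℕ → ℕ}
    (hn : Tendsto n atTop atTop) (σ : ∀ k, ApproxPath X L (h k)) {x : X}
    (hx : ∀ k, (σ k).toFun (σ k).time = x) {T : ℝ} (hT1 : ∀ k, (σ k).time ≤ 1)
    (hT : Tendsto (fun k => (σ k).time) atTop (𝓝 T)) {γ : ℝ → X} (hγ : LipschitzWith L γ)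
    (hσγ : ∀ s, Tendsto (fun k => (σ k).clamp s) atTop (𝓝 (γ s))) {a : ℝ≥0∞}
    (ha : ∀ k, (σ k).cost U (reg g δ (n k)) ≤ a) : ENNReal.ofReal (u x) ≤ a := by
  have hγT : ∀ s, T < s → γ s = x := fun s hs => by
    refine tendsto_nhds_unique (hσγ s) (tendsto_const_nhds.congr' ?_)
    filter_upwards [hT.eventually (gt_mem_nhds hs)] with k hk
    rw [(σ k).clamp_of_time_le hk.le, hx]
  have hγ1 : γ 1 = x := by
    refine tendsto_nhds_unique (hσγ 1) (tendsto_const_nhds.congr fun k => ?_)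
    rw [(σ k).clamp_of_time_le (hT1 k), hx]
  set F : ℕ → ℝ → ℝ≥0∞ := fun k => (Ico 0 (σ k).time).indicator
    fun s => ENNReal.ofReal L * reg g δ (n k) ((σ k).clamp s) with hF
  have hFm : ∀ k, Measurable (F k) := fun k => by
    refine Measurable.indicator ?_ measurableSet_Ico
    exact ((continuous_reg g δ (n k)).measurable.comp
      (σ k).measurable_clamp).coe_nnreal_ennreal.const_mul _
  have hpt : ∀ᵐ s ∂volume.restrict (Icc (0 : ℝ) 1),
      g (γ s) * speed γ s ≤ liminf (fun k => F k s) atTop := by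
    have hne : ∀ᵐ s : ℝ ∂volume.restrict (Icc (0 : ℝ) 1), s ≠ T :=
      ae_restrict_of_ae (by simp [ae_iff])
    rw [← Measure.restrict_congr_set Ioo_ae_eq_Icc] at hne ⊢
    filter_upwards [hne, ae_restrict_mem measurableSet_Ioo] with s hsT hs
    rcases lt_or_gt_of_ne hsT with hlt | hgt
    · have h1 : speed γ s ≤ L := speed_le_of_lipschitzOnWith hγ.lipschitzOnWith hs
      have h2 : g (γ s) ≤ liminf (fun k => (reg g δ (n k) ((σ k).clamp s) : ℝ≥0∞)) atTop :=
        (le_liminf_infConv hg (hσγ s) hn).trans (liminf_le_liminf (Eventually.of_forall fun k => by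
          rw [coe_reg]; exact le_self_add))
      calc g (γ s) * speed γ s ≤ ENNReal.ofReal L *
            liminf (fun k => (reg g δ (n k) ((σ k).clamp s) : ℝ≥0∞)) atTop := by
              rw [mul_comm, ENNReal.ofReal_coe_nnreal]
              exact mul_le_mul' h1 h2
        _ = liminf (fun k => ENNReal.ofReal L * (reg g δ (n k) ((σ k).clamp s) : ℝ≥0∞)) atTop :=
              (ENNReal.liminf_const_mul_of_ne_top ENNReal.ofReal_ne_top).symm
        _ ≤ _ := by
              refine liminf_le_liminf ?_
              filter_upwards [hT.eventually (lt_mem_nhds hlt)] with k hk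
              have hsk : s ∈ Ico 0 (σ k).time := ⟨hs.1.le, hk⟩
              simp only [hF, indicator_of_mem hsk]
              exact le_rfl
    · have : speed γ s ≤ (0 : ℝ≥0) := speed_le_of_eventually (by
        filter_upwards [lt_mem_nhds hgt] with t ht
        rw [hγT t ht, hγT s hgt, dist_self]
        simp)
      rw [ENNReal.coe_zero, nonpos_iff_eq_zero] at this
      simp [this]
  have hUG := hgu ⟨γ, L, hγ.lipschitzOnWith⟩ fun t _ => mem_univ _
  simp only [hγ1] at hUG
  have hcurve : curveIntegral g ⟨γ, L, hγ.lipschitzOnWith⟩ ≤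
      liminf (fun k => ∫⁻ s in Ico 0 (σ k).time,
        ENNReal.ofReal L * reg g δ (n k) ((σ k).toFun s)) atTop := by
    refine (lintegral_mono_ae hpt).trans ((lintegral_liminf_le hFm).trans
      (liminf_le_liminf (Eventually.of_forall fun k => ?_)))
    refine (setLIntegral_le_lintegral _ _).trans (le_of_eq ?_)
    simp only [hF]
    rw [lintegral_indicator measurableSet_Ico]
    refine setLIntegral_congr_fun measurableSet_Ico fun s hs => ?_
    simp only [(σ k).clamp_of_mem (Ico_subset_Icc_self hs)]
  have hU0 : ENNReal.ofReal (u (γ 0)) ≤ liminf (fun k => U ((σ k).toFun 0)) atTop := by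
    refine (huU _).trans ((le_liminf_comp hU (hσγ 0)).trans_eq ?_)
    congr 1
    ext k
    rw [(σ k).clamp_of_mem ⟨le_rfl, (σ k).time_nonneg⟩]
  calc ENNReal.ofReal (u x) ≤ ENNReal.ofReal (u (γ 0)) + ENNReal.ofReal |u x - u (γ 0)| := by
        refine (ENNReal.ofReal_le_ofReal ?_).trans ENNReal.ofReal_add_le
        linarith [le_abs_self (u x - u (γ 0))]
    _ ≤ _ := add_le_add hU0 (hUG.trans hcurve)
    _ ≤ a := liminf_add_liminf_le ha

/-- The chain functions bound the original function from below in the limit. -/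
lemma eventually_le_chainInf [BorelSpace X] [ProperSpace X] {u : X → ℝ} {g U : X → ℝ≥0∞}
    (hg : LowerSemicontinuous g) (hU : LowerSemicontinuous U) (hgu : IsUpperGradientOn g u univ)
    (huU : ∀ y, ENNReal.ofReal (u y) ≤ U y) {δ L : ℝ≥0} (hL : 1 ≤ L * δ) {h : ℕ → ℝ}
    (hh : Tendsto h atTop (𝓝 0)) (hh1 : ∀ n, h n ≤ 1) {x : X} {a : ℝ≥0∞}
    (ha : a < ENNReal.ofReal (u x)) (ha1 : a ≤ 1) :
    ∀ᶠ n in atTop, a ≤ chainInf U (reg g δ n) L (h n) x := by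
  by_contra hcon
  rw [not_eventually] at hcon
  obtain ⟨φ, hφ, hlt⟩ := extraction_of_frequently_atTop hcon
  simp only [not_le, chainInf, iInf_lt_iff] at hlt
  choose σ hσx hσa using hlt
  have hT1 : ∀ k, (σ k).time ≤ 1 := fun k => by
    have h1 : ENNReal.ofReal (σ k).time ≤ 1 :=
      ((σ k).ofReal_time_le_cost fun y => by
        rw [ENNReal.ofReal_coe_nnreal]
        exact_mod_cast hL.trans (mul_le_mul_right (le_reg g δ _ y) L)).trans
          ((hσa k).le.trans ha1)
    rwa [ENNReal.ofReal_le_one] at h1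
  obtain ⟨T, -, φ₁, hφ₁, hT⟩ := (isCompact_Icc (a := (0 : ℝ)) (b := 1)).tendsto_subseq
    (x := fun k => (σ k).time) fun k => ⟨(σ k).time_nonneg, hT1 k⟩
  obtain ⟨φ₂, hφ₂, γ, hγ, hconv⟩ := exists_subseq_tendsto_lipschitzWith
    (isCompact_closedBall x (L + 1)) (τ := fun k => (σ (φ₁ k)).clamp)
    (h := fun k => h (φ (φ₁ k))) (L := L)
    (fun k s => by
      have := (σ (φ₁ k)).dist_clamp_end_le L.coe_nonneg (hT1 _) s
      rw [hσx] at this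
      exact mem_closedBall.2 (this.trans (add_le_add le_rfl (hh1 _))))
    (hh.comp (hφ.comp hφ₁).tendsto_atTop)
    (fun k s t => (σ (φ₁ k)).dist_clamp_le L.coe_nonneg s t)
  refine absurd (ofReal_le_of_tendsto_approxPath hg hU hgu huU
    (n := fun k => φ (φ₁ (φ₂ k))) (hφ.comp (hφ₁.comp hφ₂)).tendsto_atTop
    (fun k => σ (φ₁ (φ₂ k))) (fun k => hσx _) (fun k => hT1 _) (hT.comp hφ₂.tendsto_atTop) hγ
    hconv (fun k => (hσa _).le)) (not_le.2 ha)

section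

lemma lowerSemicontinuous_indicator_of_isOpen {U : X → ℝ≥0∞} (hU : LowerSemicontinuous U)
    {S : Set X} (hS : IsOpen S) : LowerSemicontinuous (S.indicator U) := by
  intro y m hm
  by_cases hy : y ∈ S
  · rw [indicator_of_mem hy] at hm
    filter_upwards [hU y m hm, hS.mem_nhds hy] with z hz hzS
    rwa [indicator_of_mem hzS]
  · rw [indicator_of_notMem hy] at hm
    exact absurd hm not_lt_zero

variable [BorelSpace X] [ProperSpace X]

lemma hasEnergyLE_chainFun {μ : Measure X} {U g : X → ℝ≥0∞} {δ L : ℝ≥0} (hL : 0 < L) {h : ℝ}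
    (hh : 0 < h) (hg : Measurable g) (n : ℕ) {S : Set X} (hS : IsClosed S)
    (hUS : ∀ y ∉ S, U y = 0) :
    HasEnergyLE μ (chainFun U (reg g δ n) L h) (∫⁻ x, g x ∂μ + δ * μ S) := by
  have hL' : (0 : ℝ) < L := hL
  refine ⟨locLipschitzOn_chainFun hL' hh (reg_le_natCast_add g δ n), _,
    ((continuous_reg g δ n).measurable.indicator hS.measurableSet).coe_nnreal_ennreal,
    isUpperGradientOn_chainFun hL' hh (reg_le_natCast_add g δ n) (continuous_reg g δ n) hS hUS, ?_⟩
  calc ∫⁻ y, ((S.indicator (reg g δ n) y : ℝ≥0) : ℝ≥0∞) ∂μ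
      ≤ ∫⁻ y, (g y + S.indicator (fun _ => (δ : ℝ≥0∞)) y) ∂μ := by
        refine lintegral_mono fun y => ?_
        by_cases hy : y ∈ S
        · simp only [indicator_of_mem hy]
          exact coe_reg_le g δ n y
        · simp [indicator_of_notMem hy]
    _ = _ := by
        rw [lintegral_add_left hg, lintegral_indicator_const hS.measurableSet]

lemma tendsto_ofReal_sub_chainFun {u : X → ℝ} {g U : X → ℝ≥0∞}
    (hg : LowerSemicontinuous g) (hU : LowerSemicontinuous U) (hgu : IsUpperGradientOn g u univ)
    (huU : ∀ y, ENNReal.ofReal (u y) ≤ U y) {δ L : ℝ≥0} (hL : 1 ≤ L * δ) {h : ℕ → ℝ}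
    (hh : Tendsto h atTop (𝓝 0)) (hh1 : ∀ n, h n ≤ 1) {x : X} (hx : u x ≤ 1) :
    Tendsto (fun n => ENNReal.ofReal (u x - chainFun U (reg g δ n) L (h n) x)) atTop (𝓝 0) := by
  refine ENNReal.tendsto_nhds_zero.2 fun ε hε => ?_
  rcases eq_or_ne (ENNReal.ofReal (u x)) 0 with h0 | h0
  · refine Eventually.of_forall fun n => ?_
    rw [ENNReal.ofReal_sub _ (chainFun_nonneg _ _ _ _ _), h0, zero_tsub]
    exact zero_le
  · have hx1 : ENNReal.ofReal (u x) ≤ 1 := by rwa [ENNReal.ofReal_le_one]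
    filter_upwards [eventually_le_chainInf hg hU hgu huU hL hh hh1
      (ENNReal.sub_lt_self ENNReal.ofReal_ne_top h0 hε.ne') (tsub_le_self.trans hx1)] with n hn
    rw [ENNReal.ofReal_sub _ (chainFun_nonneg _ _ _ _ _), ofReal_chainFun, tsub_le_iff_tsub_le]
    exact le_min (tsub_le_self.trans hx1) hn

/-- Functions with bounded support are approximated by locally Lipschitz functions whose energy is
controlled by an upper gradient. -/
theorem IsUpperGradientOn.approximable {μ : Measure X} [IsLocallyFiniteMeasure μ] {u : X → ℝ}
    {g : X → ℝ≥0∞} (hgu : IsUpperGradientOn g u univ) (hg : Measurable g) (hu : AEMeasurable u μ)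
    (h0 : ∀ y, 0 ≤ u y) (h1 : ∀ y, u y ≤ 1) {x₀ : X} {R : ℝ} (hoff : ∀ y ∉ ball x₀ R, u y = 0)
    {c : ℝ≥0∞} (hc : ∫⁻ x, g x ∂μ < c) : Approximable μ c u := by
  intro K _ ε hε
  obtain ⟨e, hge, hec⟩ := exists_between hc
  obtain ⟨g', hgg', hg', hint⟩ := exists_le_lowerSemicontinuous_lintegral_ge μ g hg
    (tsub_pos_iff_lt.2 hge).ne'
  rw [add_tsub_cancel_of_le hge.le] at hint
  have hfin : μ (closedBall x₀ R) ≠ ⊤ := (isCompact_closedBall x₀ R).measure_lt_top.ne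
  obtain ⟨δ, hδ, hδc⟩ := ENNReal.exists_nnreal_pos_mul_lt hfin (tsub_pos_iff_lt.2 hec).ne'
  have hε2 : ε / 2 ≠ 0 := (ENNReal.half_pos hε).ne'
  obtain ⟨U, huU, hU, hUint⟩ := exists_lt_lowerSemicontinuous_lintegral_ge_of_aemeasurable (μ := μ)
    (fun y => (u y).toNNReal) hu.real_toNNReal hε2
  change ∫⁻ y, U y ∂μ ≤ ∫⁻ y, ENNReal.ofReal (u y) ∂μ + ε / 2 at hUint
  set V := (ball x₀ R).indicator U with hV
  have hVlsc : LowerSemicontinuous V := lowerSemicontinuous_indicator_of_isOpen hU isOpen_ball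
  have huV : ∀ y, ENNReal.ofReal (u y) ≤ V y := fun y => by
    by_cases hy : y ∈ ball x₀ R
    · rw [hV, indicator_of_mem hy]; exact (huU y).le
    · rw [hoff y hy]; simp
  have hVint : ∫⁻ y, V y ∂μ ≤ ∫⁻ y, ENNReal.ofReal (u y) ∂μ + ε / 2 :=
    (lintegral_mono fun y => indicator_le_self _ _ _).trans hUint
  have hgu' : IsUpperGradientOn g' u univ := fun γ hγ =>
    (hgu γ hγ).trans (curveIntegral_mono hgg' γ)
  have hL : 1 ≤ δ⁻¹ * δ := (inv_mul_cancel₀ hδ.ne').ge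
  have hL0 : 0 < δ⁻¹ := inv_pos.2 hδ
  set h : ℕ → ℝ := fun n => 1 / ((n : ℝ) + 1) with hh
  have hpos : ∀ n, 0 < h n := fun n => Nat.one_div_pos_of_nat
  have hh0 : Tendsto h atTop (𝓝 0) := tendsto_one_div_add_atTop_nhds_zero_nat
  have hh1 : ∀ n, h n ≤ 1 := fun n => by
    rw [hh]; exact (div_le_one (by positivity)).2 (by linarith [n.cast_nonneg (α := ℝ)])
  set f : ℕ → X → ℝ := fun n => chainFun V (reg g' δ n) (δ⁻¹ : ℝ≥0) (h n) with hf
  have hE : ∀ n, HasEnergyLE μ (f n) c := fun n => by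
    obtain ⟨hl, k, hk, hkf, hkint⟩ := hasEnergyLE_chainFun (μ := μ) (U := V) (δ := δ) hL0 (hpos n)
      hg'.measurable n (isClosed_closedBall (x := x₀) (ε := R)) fun y hy =>
        indicator_of_notMem (fun hy' => hy (ball_subset_closedBall hy')) _
    refine ⟨hl, k, hk, hkf, hkint.trans ?_⟩
    exact (add_le_add hint hδc.le).trans (add_tsub_cancel_of_le hec.le).le
  have hlim : Tendsto (fun n => ∫⁻ y, ENNReal.ofReal (u y - f n y) ∂μ) atTop (𝓝 0) := by
    rw [show (0 : ℝ≥0∞) = ∫⁻ _, 0 ∂μ by simp]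
    refine tendsto_lintegral_of_dominated_convergence' ((ball x₀ R).indicator fun _ => 1)
      (fun n => (hu.sub (hE n).measurable.aemeasurable).ennreal_ofReal)
      (fun n => Eventually.of_forall fun y => ?_) ?_ (Eventually.of_forall fun y => ?_)
    · have hfn : 0 ≤ f n y := chainFun_nonneg _ _ _ _ _
      beta_reduce
      by_cases hy : y ∈ ball x₀ R
      · rw [indicator_of_mem hy, ENNReal.ofReal_le_one]; linarith [h1 y]
      · rw [hoff y hy, ENNReal.ofReal_of_nonpos (by linarith)]; exact zero_le
    · rw [lintegral_indicator_const isOpen_ball.measurableSet, one_mul]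
      exact measure_ball_lt_top.ne
    · exact tendsto_ofReal_sub_chainFun hg' hVlsc hgu' huV hL hh0 hh1 (h1 y)
  obtain ⟨n, hn⟩ := (ENNReal.tendsto_nhds_zero.1 hlim (ε / 2) (pos_iff_ne_zero.2 hε2)).exists
  refine ⟨f n, hE n, (setLIntegral_le_lintegral _ _).trans ?_⟩
  have hufin : ∫⁻ y, ENNReal.ofReal (u y) ∂μ ≠ ⊤ := by
    refine ne_top_of_le_ne_top (measure_ball_lt_top (μ := μ) (x := x₀) (r := R)).ne ?_
    rw [← one_mul (μ _), ← lintegral_indicator_const isOpen_ball.measurableSet]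
    refine lintegral_mono fun y => ?_
    by_cases hy : y ∈ ball x₀ R
    · rw [indicator_of_mem hy, ENNReal.ofReal_le_one]; exact h1 y
    · rw [hoff y hy]; simp
  calc ∫⁻ y, ENNReal.ofReal |f n y - u y| ∂μ
      ≤ ∫⁻ y, ((V y - ENNReal.ofReal (u y)) + ENNReal.ofReal (u y - f n y)) ∂μ := by
        refine lintegral_mono fun y => ?_
        rcases le_total (u y) (f n y) with huf | huf
        · rw [abs_of_nonneg (sub_nonneg.2 huf), ENNReal.ofReal_sub _ (h0 y)]
          exact (tsub_le_tsub_right (ofReal_chainFun_le (NNReal.coe_nonneg _) (hpos n).le y) _).trans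
            le_self_add
        · rw [abs_of_nonpos (sub_nonpos.2 huf), neg_sub]
          exact le_add_self
    _ = ∫⁻ y, (V y - ENNReal.ofReal (u y)) ∂μ + ∫⁻ y, ENNReal.ofReal (u y - f n y) ∂μ :=
        lintegral_add_right' _ (hu.sub (hE n).measurable.aemeasurable).ennreal_ofReal
    _ ≤ ε / 2 + ε / 2 := by
        refine add_le_add ?_ hn
        rw [lintegral_sub' hu.ennreal_ofReal hufin (Eventually.of_forall huV)]
        exact tsub_le_iff_left.2 hVint
    _ = ε := ENNReal.add_halves ε

end

/-- In a Hilbert space, a decreasing sequence of nonempty, uniformly bounded convex sets admits a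
convergent selection. -/
lemma exists_tendsto_of_antitone_convex {H : Type*} [NormedAddCommGroup H] [InnerProductSpace ℝ H]
    [CompleteSpace H] {C : ℕ → Set H} (hC : Antitone C) (hne : ∀ n, (C n).Nonempty)
    (hconv : ∀ n, Convex ℝ (C n)) {M : ℝ} (hM : ∀ n, ∀ f ∈ C n, ‖f‖ ≤ M) :
    ∃ (v : ℕ → H) (w : H), (∀ n, v n ∈ C n) ∧ Tendsto v atTop (𝓝 w) := by
  set s : ℕ → ℝ := fun n => sInf ((fun f => ‖f‖ ^ 2) '' C n) with hs
  have hbdd : ∀ n, BddBelow ((fun f : H => ‖f‖ ^ 2) '' C n) := fun n =>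
    ⟨0, by rintro _ ⟨f, -, rfl⟩; positivity⟩
  have hle : ∀ n, ∀ f ∈ C n, s n ≤ ‖f‖ ^ 2 := fun n f hf =>
    csInf_le (hbdd n) (mem_image_of_mem _ hf)
  have hmono : Monotone s := fun n m hnm =>
    csInf_le_csInf (hbdd n) ((hne m).image _) (image_mono (hC hnm))
  have hsM : ∀ n, s n ≤ M ^ 2 := fun n => by
    obtain ⟨f, hf⟩ := hne n
    exact (hle n f hf).trans (pow_le_pow_left₀ (norm_nonneg f) (hM n f hf) 2)
  have hlim : Tendsto s atTop (𝓝 (⨆ n, s n)) :=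
    tendsto_atTop_ciSup hmono ⟨M ^ 2, by rintro _ ⟨n, rfl⟩; exact hsM n⟩
  have hsup : ∀ n, s n ≤ ⨆ n, s n := fun n =>
    le_ciSup ⟨M ^ 2, by rintro _ ⟨n, rfl⟩; exact hsM n⟩ n
  have hex : ∀ n : ℕ, ∃ f ∈ C n, ‖f‖ ^ 2 < s n + 1 / ((n : ℝ) + 1) := fun n => by
    obtain ⟨_, ⟨f, hf, rfl⟩, hlt⟩ := exists_lt_of_csInf_lt ((hne n).image fun f : H => ‖f‖ ^ 2)
      (lt_add_of_pos_right (s n) (by positivity : (0 : ℝ) < 1 / ((n : ℝ) + 1)))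
    exact ⟨f, hf, hlt⟩
  choose v hvC hv using hex
  have hdist : ∀ n m, n ≤ m →
      ‖v n - v m‖ ^ 2 ≤ 2 * ((⨆ n, s n) - s n) + 4 * (1 / ((n : ℝ) + 1)) := fun n m hnm => by
    have hmid := hle n _ (hconv n (hvC n) (hC hnm (hvC m)) (by norm_num : (0 : ℝ) ≤ 1 / 2)
      (by norm_num : (0 : ℝ) ≤ 1 / 2) (by norm_num))
    rw [← smul_add, norm_smul, mul_pow] at hmid
    norm_num at hmid
    have hpar := parallelogram_law_with_norm ℝ (v n) (v m)
    have hεm : 1 / ((m : ℝ) + 1) ≤ 1 / ((n : ℝ) + 1) := by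
      gcongr
    nlinarith [hv n, hv m, hsup m]
  have hcauchy : CauchySeq v := by
    rw [Metric.cauchySeq_iff']
    intro ε hε
    have h0 : Tendsto (fun n : ℕ => 2 * ((⨆ n, s n) - s n) + 4 * (1 / ((n : ℝ) + 1))) atTop
        (𝓝 0) := by
      have h1 := ((tendsto_const_nhds (x := ⨆ n, s n)).sub hlim).const_mul 2
      have h2 := (tendsto_one_div_add_atTop_nhds_zero_nat (𝕜 := ℝ)).const_mul 4
      simpa using h1.add h2
    obtain ⟨N, hN⟩ := (h0.eventually (gt_mem_nhds (by positivity : 0 < ε ^ 2))).exists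
    refine ⟨N, fun n hn => ?_⟩
    rw [dist_comm, dist_eq_norm]
    exact lt_of_pow_lt_pow_left₀ 2 hε.le ((hdist N n hn).trans_lt hN)
  obtain ⟨w, hw⟩ := cauchySeq_tendsto_of_complete hcauchy
  exact ⟨v, w, hvC, hw⟩

/-- The competitors with values in `[0, 1]` for the obstacle problem with obstacle `χ_A` and
vanishing boundary values outside `Ω`. -/
structure Admissible (μ : Measure X) (A Ω : Set X) (v : X → ℝ) : Prop where
  aemeasurable : AEMeasurable v μ
  nonneg : ∀ᵐ y ∂μ, 0 ≤ v y
  le_one : ∀ᵐ y ∂μ, v y ≤ 1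
  one_le : ∀ᵐ y ∂μ, y ∈ A → 1 ≤ v y
  eq_zero : ∀ᵐ y ∂μ, y ∉ Ω → v y = 0

section Admissible

variable {μ : Measure X} {A Ω : Set X} {v w : X → ℝ}

lemma Admissible.congr_ae (hv : Admissible μ A Ω v) (h : v =ᵐ[μ] w) : Admissible μ A Ω w where
  aemeasurable := hv.aemeasurable.congr h
  nonneg := by filter_upwards [hv.nonneg, h] with y hy h; rwa [← h]
  le_one := by filter_upwards [hv.le_one, h] with y hy h; rwa [← h]
  one_le := by filter_upwards [hv.one_le, h] with y hy h; rwa [← h]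
  eq_zero := by filter_upwards [hv.eq_zero, h] with y hy h; rwa [← h]

lemma Admissible.add (hv : Admissible μ A Ω v) (hw : Admissible μ A Ω w) {a b : ℝ} (ha : 0 ≤ a)
    (hb : 0 ≤ b) (hab : a + b = 1) : Admissible μ A Ω (fun y => a * v y + b * w y) where
  aemeasurable := (hv.aemeasurable.const_mul a).add (hw.aemeasurable.const_mul b)
  nonneg := by filter_upwards [hv.nonneg, hw.nonneg] with y h1 h2; positivity
  le_one := by filter_upwards [hv.le_one, hw.le_one] with y h1 h2; nlinarith
  one_le := by
    filter_upwards [hv.one_le, hw.one_le] with y h1 h2 hy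
    nlinarith [h1 hy, h2 hy]
  eq_zero := by
    filter_upwards [hv.eq_zero, hw.eq_zero] with y h1 h2 hy
    simp [h1 hy, h2 hy]

lemma Admissible.comp (hv : Admissible μ A Ω v) {F : ℝ → ℝ} (hF : Measurable F)
    (hF0 : F 0 = 0) (hF1 : F 1 = 1) (hI : ∀ t, 0 ≤ t → t ≤ 1 → 0 ≤ F t ∧ F t ≤ 1) :
    Admissible μ A Ω (fun y => F (v y)) where
  aemeasurable := hF.comp_aemeasurable hv.aemeasurable
  nonneg := by filter_upwards [hv.nonneg, hv.le_one] with y h1 h2 using (hI _ h1 h2).1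
  le_one := by filter_upwards [hv.nonneg, hv.le_one] with y h1 h2 using (hI _ h1 h2).2
  one_le := by
    filter_upwards [hv.le_one, hv.one_le] with y h1 h2 hy
    rw [le_antisymm h1 (h2 hy), hF1]
  eq_zero := by
    filter_upwards [hv.eq_zero] with y h hy
    rw [h hy, hF0]

lemma Admissible.of_tendsto {v : ℕ → X → ℝ} {u : X → ℝ} (hv : ∀ n, Admissible μ A Ω (v n))
    (hlim : ∀ᵐ y ∂μ, Tendsto (fun n => v n y) atTop (𝓝 (u y))) : Admissible μ A Ω u where
  aemeasurable := aemeasurable_of_tendsto_metrizable_ae atTop (fun n => (hv n).aemeasurable) hlim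
  nonneg := by
    filter_upwards [hlim, ae_all_iff.2 fun n => (hv n).nonneg] with y h1 h2
    exact ge_of_tendsto' h1 h2
  le_one := by
    filter_upwards [hlim, ae_all_iff.2 fun n => (hv n).le_one] with y h1 h2
    exact le_of_tendsto' h1 h2
  one_le := by
    filter_upwards [hlim, ae_all_iff.2 fun n => (hv n).one_le] with y h1 h2 hy
    exact ge_of_tendsto' h1 fun n => h2 n hy
  eq_zero := by
    filter_upwards [hlim, ae_all_iff.2 fun n => (hv n).eq_zero] with y h1 h2 hy
    exact tendsto_nhds_unique h1 (by simp [h2 _ hy])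

lemma Admissible.abs_le_indicator (hv : Admissible μ A Ω v) :
    ∀ᵐ y ∂μ, |v y| ≤ Ω.indicator (fun _ => (1 : ℝ)) y := by
  filter_upwards [hv.nonneg, hv.le_one, hv.eq_zero] with y h0 h1 h2
  by_cases hy : y ∈ Ω
  · rw [indicator_of_mem hy, abs_of_nonneg h0]; exact h1
  · rw [indicator_of_notMem hy, h2 hy, abs_zero]

lemma Admissible.memLp (hv : Admissible μ A Ω v) (hΩ : MeasurableSet Ω) (hΩμ : μ Ω ≠ ⊤)
    (p : ℝ≥0∞) : MemLp v p μ :=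
  (memLp_indicator_const p hΩ (1 : ℝ) (Or.inr hΩμ)).of_le hv.aemeasurable.aestronglyMeasurable <| by
    filter_upwards [hv.abs_le_indicator] with y hy
    exact hy.trans (le_abs_self _)

end Admissible

section Minimizer

variable [BorelSpace X] [ProperSpace X]

lemma Approximable.of_tendsto_ae {μ : Measure X} [IsLocallyFiniteMeasure μ] {v : ℕ → X → ℝ}
    {u : X → ℝ} {c : ℝ≥0∞} {M : ℝ} (hv : ∀ n, AEMeasurable (v n) μ) (hu : AEMeasurable u μ)
    (hb : ∀ n, ∀ᵐ y ∂μ, |v n y - u y| ≤ M)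
    (hlim : ∀ᵐ y ∂μ, Tendsto (fun n => v n y) atTop (𝓝 (u y)))
    (hc : ∀ᶠ n in atTop, Approximable μ c (v n)) : Approximable μ c u := by
  refine .of_forall_exists fun K hK ε hε => ?_
  have h0 : Tendsto (fun n => ∫⁻ y in K, ENNReal.ofReal |v n y - u y| ∂μ) atTop
      (𝓝 (∫⁻ _ in K, 0 ∂μ)) := by
    refine tendsto_lintegral_of_dominated_convergence' (fun _ => ENNReal.ofReal M) (fun n => ?_)
      (fun n => ?_) ?_ ?_
    · exact (((hv n).sub hu).norm.ennreal_ofReal).restrict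
    · filter_upwards [ae_restrict_of_ae (hb n)] with y hy using ENNReal.ofReal_le_ofReal hy
    · rw [setLIntegral_const]
      exact ENNReal.mul_ne_top ENNReal.ofReal_ne_top hK.measure_lt_top.ne
    · filter_upwards [ae_restrict_of_ae hlim] with y hy
      have := ENNReal.tendsto_ofReal (hy.sub_const (u y)).abs
      simpa using this
  rw [lintegral_zero] at h0
  obtain ⟨n, hn, hnc⟩ := ((h0.eventually (ge_mem_nhds (pos_iff_ne_zero.2 hε))).and hc).exists
  exact ⟨v n, hv n, hnc, hn⟩

lemma exists_seq_admissible_tendsto {μ : Measure X} {A Ω : Set X}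
    (hΩ : MeasurableSet Ω) (hΩμ : μ Ω ≠ ⊤) {c : ℕ → ℝ≥0∞} (hc : Antitone c)
    (hne : ∀ n, ∃ v, Admissible μ A Ω v ∧ Approximable μ (c n) v) :
    ∃ (v : ℕ → X → ℝ) (u : X → ℝ), (∀ n, Admissible μ A Ω (v n) ∧ Approximable μ (c n) (v n)) ∧
      ∀ᵐ y ∂μ, Tendsto (fun n => v n y) atTop (𝓝 (u y)) := by
  let C : ℕ → Set (Lp ℝ 2 μ) := fun n => {f | Admissible μ A Ω f ∧ Approximable μ (c n) f}
  have hanti : Antitone C := fun n m hnm f hf => ⟨hf.1, hf.2.mono (hc hnm)⟩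
  have hCne : ∀ n, (C n).Nonempty := fun n => by
    obtain ⟨v, hv, hva⟩ := hne n
    have h := (hv.memLp hΩ hΩμ 2).coeFn_toLp
    exact ⟨(hv.memLp hΩ hΩμ 2).toLp v, hv.congr_ae h.symm, hva.congr_ae h.symm⟩
  have hconv : ∀ n, Convex ℝ (C n) := by
    intro n f hf g hg a b ha hb hab
    have hcoe : (fun y => a * f y + b * g y) =ᵐ[μ] (a • f + b • g : Lp ℝ 2 μ) := by
      filter_upwards [Lp.coeFn_add (a • f) (b • g), Lp.coeFn_smul a f, Lp.coeFn_smul b g]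
        with y h1 h2 h3
      rw [h1, Pi.add_apply, h2, h3]; rfl
    refine ⟨(hf.1.add hg.1 ha hb hab).congr_ae hcoe, ?_⟩
    rcases ha.eq_or_lt with rfl | ha'
    · obtain rfl : b = 1 := by linarith
      simpa using hg.2
    rcases hb.eq_or_lt with rfl | hb'
    · obtain rfl : a = 1 := by linarith
      simpa using hf.2
    refine Approximable.congr_ae ?_ hcoe
    refine ((hf.2.const_mul ha').add (hg.2.const_mul hb')
      (hf.1.aemeasurable.const_mul a)).mono ?_
    rw [← add_mul, ← ENNReal.ofReal_add ha hb, hab, ENNReal.ofReal_one, one_mul]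
  have hbound : ∀ n, ∀ f ∈ C n, ‖f‖ ≤ ‖indicatorConstLp 2 hΩ hΩμ (1 : ℝ)‖ := fun n f hf => by
    refine Lp.norm_le_norm_of_ae_le ?_
    filter_upwards [hf.1.abs_le_indicator, indicatorConstLp_coeFn (p := 2) (hs := hΩ)
      (hμs := hΩμ) (c := (1 : ℝ))] with y h1 h2
    rw [h2]
    exact h1.trans (le_abs_self _)
  obtain ⟨v, w, hv, hvw⟩ := exists_tendsto_of_antitone_convex hanti hCne hconv hbound
  have hmeas : TendstoInMeasure μ (fun n => (v n : X → ℝ)) atTop w :=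
    tendstoInMeasure_of_tendsto_Lp hvw
  obtain ⟨φ, hφ, hlim⟩ := hmeas.exists_seq_tendsto_ae
  refine ⟨fun n => v (φ n), w, fun n => ⟨(hv (φ n)).1, (hv (φ n)).2.mono (hc ?_)⟩, hlim⟩
  exact hφ.le_apply

lemma exists_admissible_isMinOn_tv {μ : Measure X} [IsLocallyFiniteMeasure μ] {A Ω : Set X}
    (hΩ : MeasurableSet Ω) (hΩμ : μ Ω ≠ ⊤) {v₀ : X → ℝ} (hv₀ : Admissible μ A Ω v₀)
    (htop : tv μ v₀ univ < ⊤) :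
    ∃ u, Admissible μ A Ω u ∧ ∀ v, Admissible μ A Ω v → tv μ u univ ≤ tv μ v univ := by
  set I : ℝ≥0∞ := ⨅ (v : X → ℝ) (_ : Admissible μ A Ω v), tv μ v univ with hI
  have hItop : I < ⊤ := (iInf₂_le v₀ hv₀).trans_lt htop
  obtain ⟨c, hcanti, hcI, hclim⟩ := exists_seq_strictAnti_tendsto' hItop
  have hne : ∀ n, ∃ v, Admissible μ A Ω v ∧ Approximable μ (c n) v := fun n => by
    have h := (hcI n).1
    simp only [hI, iInf_lt_iff] at h
    obtain ⟨v, hv, hlt⟩ := h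
    exact ⟨v, hv, approximable_of_tv_lt hlt⟩
  obtain ⟨v, u, hv, hlim⟩ := exists_seq_admissible_tendsto hΩ hΩμ hcanti.antitone hne
  have hu : Admissible μ A Ω u := .of_tendsto (fun n => (hv n).1) hlim
  refine ⟨u, hu, fun w hw => le_trans ?_ (hI.trans_le (iInf₂_le w hw) : I ≤ tv μ w univ)⟩
  refine le_of_forall_gt_imp_ge_of_dense fun d hd => ?_
  refine (Approximable.of_tendsto_ae (M := 1) (fun n => (hv n).1.aemeasurable) hu.aemeasurable
    (fun n => ?_) hlim ?_).tv_le
  · filter_upwards [(hv n).1.nonneg, (hv n).1.le_one, hu.nonneg, hu.le_one] with y h1 h2 h3 h4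
    rw [abs_le]; constructor <;> linarith
  · filter_upwards [hclim.eventually (gt_mem_nhds hd)] with n hn
    exact (hv n).2.mono hn.le

/-- Truncating a minimizer at a level `c ∈ (0, 1)` and rescaling does not increase its total
variation. -/
lemma tv_min_div_le {μ : Measure X} {A Ω : Set X} {u : X → ℝ} (hu : Admissible μ A Ω u)
    (hmin : ∀ v, Admissible μ A Ω v → tv μ u univ ≤ tv μ v univ) (htop : tv μ u univ ≠ ⊤)
    {c : ℝ} (hc0 : 0 < c) (hc1 : c < 1) :
    tv μ (fun y => c⁻¹ * min (u y) c) univ ≤ tv μ u univ := by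
  have hd : 0 < 1 - c := by linarith
  have hmax : tv μ u univ ≤ ENNReal.ofReal (1 - c)⁻¹ * tv μ (fun y => max (u y - c) 0) univ := by
    refine le_trans (hmin _ ?_) (tv_const_mul_le _ (inv_pos.2 hd))
    refine hu.comp (F := fun t => (1 - c)⁻¹ * max (t - c) 0) (by fun_prop) ?_ ?_ fun t h0 h1 => ?_
    · simp [hc0.le]
    · rw [max_eq_left hd.le, inv_mul_cancel₀ hd.ne']
    · refine ⟨by positivity, ?_⟩
      rw [inv_mul_le_iff₀ hd, mul_one]
      exact max_le (by linarith) hd.le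
  have hmax' : ENNReal.ofReal (1 - c) * tv μ u univ ≤ tv μ (fun y => max (u y - c) 0) univ := by
    calc _ ≤ ENNReal.ofReal (1 - c) *
          (ENNReal.ofReal (1 - c)⁻¹ * tv μ (fun y => max (u y - c) 0) univ) := by gcongr
      _ = _ := by rw [← mul_assoc, ← ENNReal.ofReal_mul hd.le, mul_inv_cancel₀ hd.ne',
        ENNReal.ofReal_one, one_mul]
  have hsplit : ENNReal.ofReal c * tv μ u univ + ENNReal.ofReal (1 - c) * tv μ u univ
      = tv μ u univ := by
    rw [← add_mul, ← ENNReal.ofReal_add hc0.le hd.le, add_sub_cancel, ENNReal.ofReal_one, one_mul]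
  have hle : tv μ (fun y => min (u y) c) univ ≤ ENNReal.ofReal c * tv μ u univ := by
    have hfin : ENNReal.ofReal (1 - c) * tv μ u univ ≠ ⊤ :=
      ENNReal.mul_ne_top ENNReal.ofReal_ne_top htop
    rw [← ENNReal.add_le_add_iff_right hfin, hsplit]
    exact le_trans (by gcongr) (tv_min_add_tv_max_le u c)
  calc tv μ (fun y => c⁻¹ * min (u y) c) univ
      ≤ ENNReal.ofReal c⁻¹ * tv μ (fun y => min (u y) c) univ :=
        tv_const_mul_le _ (inv_pos.2 hc0)
    _ ≤ ENNReal.ofReal c⁻¹ * (ENNReal.ofReal c * tv μ u univ) := by gcongr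
    _ = tv μ u univ := by
      rw [← mul_assoc, ← ENNReal.ofReal_mul (inv_pos.2 hc0).le, inv_mul_cancel₀ hc0.ne',
        ENNReal.ofReal_one, one_mul]

lemma exists_set_isMinOn_tv {μ : Measure X} [IsLocallyFiniteMeasure μ] {A Ω : Set X}
    (hΩ : MeasurableSet Ω) (hΩμ : μ Ω ≠ ⊤) {v₀ : X → ℝ} (hv₀ : Admissible μ A Ω v₀)
    (htop : tv μ v₀ univ < ⊤) :
    ∃ E : Set X, Admissible μ A Ω (chi E) ∧
      ∀ v, Admissible μ A Ω v → tv μ (chi E) univ ≤ tv μ v univ := by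
  obtain ⟨u, hu, hmin⟩ := exists_admissible_isMinOn_tv hΩ hΩμ hv₀ htop
  have hutop : tv μ u univ < ⊤ := (hmin v₀ hv₀).trans_lt htop
  let c : ℕ → ℝ := fun n => ((n : ℝ) + 2)⁻¹
  have hc0 : ∀ n, 0 < c n := fun n => by positivity
  have hc1 : ∀ n, c n < 1 := fun n => inv_lt_one_of_one_lt₀ (by linarith [n.cast_nonneg (α := ℝ)])
  have hclim : Tendsto c atTop (𝓝 0) :=
    tendsto_inv_atTop_zero.comp (tendsto_atTop_add_const_right _ _ tendsto_natCast_atTop_atTop)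
  have hadm : ∀ n, Admissible μ A Ω fun y => (c n)⁻¹ * min (u y) (c n) := fun n => by
    refine hu.comp (F := fun t => (c n)⁻¹ * min t (c n)) (by fun_prop) ?_ ?_ fun t h0 h1 => ⟨?_, ?_⟩
    · simp [(hc0 n).le]
    · rw [min_eq_right (hc1 n).le, inv_mul_cancel₀ (hc0 n).ne']
    · exact mul_nonneg (inv_pos.2 (hc0 n)).le (le_min h0 (hc0 n).le)
    · rw [inv_mul_le_iff₀ (hc0 n), mul_one]
      exact min_le_right _ _
  have hlim : ∀ᵐ y ∂μ, Tendsto (fun n => (c n)⁻¹ * min (u y) (c n)) atTop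
      (𝓝 (chi {z | 0 < u z} y)) := by
    filter_upwards [hu.nonneg] with y hy
    rcases hy.eq_or_lt with h | h
    · have : ∀ n, (c n)⁻¹ * min (u y) (c n) = 0 := fun n => by simp [← h, (hc0 n).le]
      have h1 : chi {z | 0 < u z} y = 0 := indicator_of_notMem (by simp [← h]) _
      simp only [this, h1, tendsto_const_nhds]
    · have h1 : chi {z | 0 < u z} y = 1 := indicator_of_mem (s := {z | 0 < u z}) h _
      rw [h1]
      refine tendsto_const_nhds.congr' ?_
      filter_upwards [hclim.eventually (gt_mem_nhds h)] with n hn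
      rw [min_eq_right hn.le, inv_mul_cancel₀ (hc0 n).ne']
  have hE : Admissible μ A Ω (chi {z | 0 < u z}) := .of_tendsto hadm hlim
  refine ⟨_, hE, fun v hv => le_trans ?_ (hmin v hv)⟩
  refine le_of_forall_gt_imp_ge_of_dense fun d hd => ?_
  refine (Approximable.of_tendsto_ae (M := 1) (fun n => (hadm n).aemeasurable) hE.aemeasurable
    (fun n => ?_) hlim (Eventually.of_forall fun n => ?_)).tv_le
  · filter_upwards [(hadm n).nonneg, (hadm n).le_one, hE.nonneg, hE.le_one] with y h1 h2 h3 h4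
    rw [abs_le]; constructor <;> linarith
  · exact approximable_of_tv_lt ((tv_min_div_le hu hmin hutop.ne (hc0 n) (hc1 n)).trans_lt hd)

end Minimizer

lemma MemBVloc.aemeasurable [BorelSpace X] [ProperSpace X] {μ : Measure X} {v : X → ℝ}
    (hv : MemBVloc μ v univ) : AEMeasurable v μ := by
  rcases isEmpty_or_nonempty X with h | ⟨⟨x₀⟩⟩
  · exact Subsingleton.measurable.aemeasurable
  have h : ∀ n : ℕ, AEMeasurable v (μ.restrict (closedBall x₀ n)) := fun n => by
    obtain ⟨U, -, hKU, -, hU, -⟩ := hv _ (isCompact_closedBall x₀ (n : ℝ)) (subset_univ _)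
    exact (hU.mono_set hKU).aemeasurable
  rw [← Measure.restrict_univ (μ := μ), ← iUnion_closedBall_nat x₀]
  exact aemeasurable_iUnion_iff.2 h

/-- The truncation of a competitor to `[0, 1]` is admissible. -/
lemma Admissible.of_ae {μ : Measure X} {A Ω : Set X} {v : X → ℝ} (hv : AEMeasurable v μ)
    (h1 : ∀ᵐ y ∂μ, y ∈ A → 1 ≤ v y) (h0 : ∀ᵐ y ∂μ, y ∉ Ω → v y = 0) :
    Admissible μ A Ω (fun y => max 0 (min (v y) 1)) where
  aemeasurable := aemeasurable_const.max (hv.min aemeasurable_const)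
  nonneg := ae_of_all _ fun y => le_max_left _ _
  le_one := ae_of_all _ fun y => max_le zero_le_one (min_le_right _ _)
  one_le := by
    filter_upwards [h1] with y h hy
    exact le_max_of_le_right (le_min (h hy) le_rfl)
  eq_zero := by
    filter_upwards [h0] with y h hy
    simp [h hy]

lemma abs_clamp_sub_clamp_le (s t : ℝ) :
    |max 0 (min s 1) - max 0 (min t 1)| ≤ |s - t| := by
  rw [max_comm 0, max_comm 0]
  exact (abs_max_sub_max_le_abs _ _ _).trans (abs_min_const_sub_le 1 s t)

/-- The cutoff function which is `1` on `ball x r` and vanishes outside `ball x R`. -/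
def cutoff (x : X) (r R : ℝ) (y : X) : ℝ := max 0 (min ((R - dist y x) / (R - r)) 1)

lemma abs_cutoff_sub_le (x : X) {r R : ℝ} (hrR : r < R) (y z : X) :
    |cutoff x r R z - cutoff x r R y| ≤ (R - r).toNNReal⁻¹ * dist z y := by
  have hd : 0 < R - r := sub_pos.2 hrR
  refine (abs_clamp_sub_clamp_le _ _).trans ?_
  rw [← sub_div, abs_div, abs_of_pos hd, NNReal.coe_inv, Real.coe_toNNReal _ hd.le, div_eq_inv_mul]
  gcongr
  rw [sub_sub_sub_cancel_left, dist_comm z y]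
  exact (abs_dist_sub_le y z x)

lemma cutoff_eq_one {x y : X} {r R : ℝ} (hrR : r < R) (hy : y ∈ ball x r) :
    cutoff x r R y = 1 := by
  have h : 1 ≤ (R - dist y x) / (R - r) := by
    rw [one_le_div (sub_pos.2 hrR)]
    linarith [mem_ball.1 hy]
  rw [cutoff, min_eq_right h, max_eq_right zero_le_one]

lemma cutoff_eq_zero {x y : X} {r R : ℝ} (hrR : r < R) (hy : y ∉ ball x R) :
    cutoff x r R y = 0 := by
  have h : (R - dist y x) / (R - r) ≤ 0 :=
    div_nonpos_of_nonpos_of_nonneg (by linarith [not_lt.1 (mem_ball.not.1 hy)])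
      (sub_pos.2 hrR).le
  exact max_eq_left ((min_le_left _ _).trans h)

section Cutoff

variable [BorelSpace X] [ProperSpace X]

lemma tv_cutoff_lt_top {μ : Measure X} [IsLocallyFiniteMeasure μ] (x : X) {r R : ℝ}
    (hrR : r < R) : tv μ (cutoff x r R) univ < ⊤ := by
  set K : ℝ≥0 := (R - r).toNNReal⁻¹
  have hlip : LipschitzWith K (cutoff x r R) := LipschitzWith.of_dist_le_mul fun z y =>
    abs_cutoff_sub_le x hrR y z
  have hloc : LocLipschitzOn (cutoff x r R) univ := fun S _ _ => ⟨K, hlip.lipschitzOnWith⟩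
  have hug : IsUpperGradientOn
      (fun y => (((closedBall x R).indicator (fun _ => K) y : ℝ≥0) : ℝ≥0∞))
      (cutoff x r R) univ := by
    refine isUpperGradientOn_of_pointwise hloc fun y M hM => ?_
    by_cases hy : y ∈ closedBall x R
    · rw [indicator_of_mem hy] at hM
      refine Eventually.of_forall fun z => (abs_cutoff_sub_le x hrR y z).trans ?_
      gcongr
    · filter_upwards [isClosed_closedBall.isOpen_compl.mem_nhds hy] with z hz
      rw [cutoff_eq_zero hrR fun h => hz (ball_subset_closedBall h),
        cutoff_eq_zero hrR fun h => hy (ball_subset_closedBall h)]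
      simp only [sub_self, abs_zero]
      positivity
  have hE : HasEnergyLE μ (cutoff x r R) (K * μ (closedBall x R)) := by
    refine ⟨hloc, _, ?_, hug, ?_⟩
    · exact (measurable_const.indicator isClosed_closedBall.measurableSet).coe_nnreal_ennreal
    · refine le_of_eq ?_
      simp_rw [ENNReal.coe_indicator]
      rw [lintegral_indicator isClosed_closedBall.measurableSet, setLIntegral_const]
  exact hE.approximable.tv_le.trans_lt
    (ENNReal.mul_lt_top ENNReal.coe_lt_top (isCompact_closedBall x R).measure_lt_top)

lemma admissible_cutoff {μ : Measure X} (x : X) {r R : ℝ} (hrR : r < R) {A : Set X}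
    (hA : A ⊆ ball x r) : Admissible μ A (ball x R) (cutoff x r R) := by
  have hm : Measurable fun y => (R - dist y x) / (R - r) := by fun_prop
  refine ⟨(measurable_const.max (hm.min measurable_const)).aemeasurable,
    ae_of_all _ fun y => le_max_left _ _,
    ae_of_all _ fun y => max_le zero_le_one (min_le_right _ _),
    ae_of_all _ fun y hy => (cutoff_eq_one hrR (hA hy)).ge,
    ae_of_all _ fun y hy => cutoff_eq_zero hrR hy⟩

lemma exists_admissible_tv_le {μ : Measure X} [IsLocallyFiniteMeasure μ] {A : Set X} {x : X}
    {R : ℝ} {u : X → ℝ} (hu : MemN11 μ u) (h1 : ∀ y ∈ A, 1 ≤ u y)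
    (h0 : ∀ y ∈ (ball x R)ᶜ, u y = 0) {g : X → ℝ≥0∞} (hg : Measurable g)
    (hgu : IsWeakUpperGradientOn μ g u univ) :
    ∃ v, Admissible μ A (ball x R) v ∧ tv μ v univ ≤ ∫⁻ y, g y ∂μ := by
  have hv : Admissible μ A (ball x R) (fun y => max 0 (min (u y) 1)) :=
    .of_ae hu.1.aemeasurable (ae_of_all _ h1) (ae_of_all _ h0)
  refine ⟨_, hv, le_of_forall_gt_imp_ge_of_dense fun c hc => ?_⟩
  obtain ⟨d, hd, hdc⟩ := exists_between hc
  obtain ⟨g', hg', hug', hle⟩ := hgu.exists_isUpperGradientOn hg (tsub_pos_iff_lt.2 hd).ne'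
  rw [add_tsub_cancel_of_le hd.le] at hle
  exact (IsUpperGradientOn.approximable (hug'.comp_of_abs_sub_le abs_clamp_sub_clamp_le) hg'
    hv.aemeasurable (fun y => le_max_left _ _) (fun y => max_le zero_le_one (min_le_right _ _)) (x₀ := x) (R := R)
    (fun y hy => by simp [h0 y hy]) (hle.trans_lt hdc)).tv_le

lemma isObstacleSolution_chi {μ : Measure X} [IsLocallyFiniteMeasure μ] {A Ω E : Set X}
    (hΩ : MeasurableSet Ω) (hΩμ : μ Ω ≠ ⊤) (hAΩ : A ⊆ Ω) (hE : Admissible μ A Ω (chi E))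
    (htop : tv μ (chi E) univ < ⊤)
    (hmin : ∀ v, Admissible μ A Ω v → tv μ (chi E) univ ≤ tv μ v univ) :
    IsObstacleSolution μ (fun y => ((chi A y : ℝ) : EReal)) (fun _ => 0) Ω (chi E) := by
  refine ⟨⟨fun K _ _ => ⟨univ, isOpen_univ, subset_univ K, subset_rfl, ?_, htop⟩, ?_, hE.eq_zero⟩,
    fun v hv => ?_⟩
  · exact (memLp_one_iff_integrable.1 (hE.memLp hΩ hΩμ 1)).integrableOn
  · filter_upwards [hE.nonneg, hE.one_le] with y h0 h1 _
    refine EReal.coe_le_coe_iff.2 ?_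
    by_cases hy : y ∈ A
    · exact (indicator_of_mem hy _).trans_le (h1 hy)
    · exact (indicator_of_notMem hy _).trans_le h0
  · have hone : ∀ᵐ y ∂μ, y ∈ A → 1 ≤ v y := by
      filter_upwards [hv.2.1] with y h hy
      have h' := EReal.coe_le_coe_iff.1 (h (hAΩ hy))
      rwa [chi, indicator_of_mem hy] at h'
    exact (hmin _ (.of_ae hv.1.aemeasurable hone hv.2.2)).trans
      (tv_comp_le v (F := fun t => max 0 (min t 1)) abs_clamp_sub_clamp_le)

end Cutoff

/-- If `x ∈ X`, `0 < r < R < (1/8) diam X` and `A ⊆ B(x,r)`, then there exists a set `E ⊆ X`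
such that `χ_E` solves the `K_{A,0}(B(x,R))`-obstacle problem and
`P(E,X) ≤ cap₁(A,B(x,R))`. -/
theorem solutions_from_capacity
    {X : Type*} [MetricSpace X] [MeasurableSpace X] [BorelSpace X]
    (μ : Measure X) (Cd CP lam : ℝ) (hX : MMS μ Cd CP lam)
    (x : X) (r R : ℝ) (hr : 0 < r) (hrR : r < R)
    (hR : ENNReal.ofReal R < EMetric.diam (Set.univ : Set X) / 8)
    (A : Set X) (hA : A ⊆ Metric.ball x r) :
    ∃ E : Set X,
      IsObstacleSolution μ (fun y => ((chi A y : ℝ) : EReal)) (fun _ => (0 : ℝ))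
        (Metric.ball x R) (chi E) ∧
      perim μ E Set.univ ≤ vcap1 μ A (Metric.ball x R) := by
  have := hX.properSpace
  have := hX.isLocallyFiniteMeasure
  have hfin : μ (ball x R) ≠ ⊤ := measure_ball_lt_top.ne
  have hcut := admissible_cutoff (μ := μ) x hrR hA
  have hcuttop := tv_cutoff_lt_top (μ := μ) x hrR
  obtain ⟨E, hE, hmin⟩ := exists_set_isMinOn_tv measurableSet_ball hfin hcut hcuttop
  refine ⟨E, isObstacleSolution_chi measurableSet_ball hfin (hA.trans (ball_subset_ball hrR.le)) hE
    ((hmin _ hcut).trans_lt hcuttop) hmin, ?_⟩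
  refine le_iInf₂ fun u hu => le_iInf₂ fun h1 h0 => le_iInf₂ fun g hg => le_iInf fun hgu => ?_
  obtain ⟨v, hv, hle⟩ := exists_admissible_tv_le hu h1 h0 hg hgu
  exact (hmin v hv).trans hle

end MetricBV
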